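/- arXiv:2303.04152 — 3 statements merged into one kernel-verified Lean document; each statement's English description precedes it below -/
import Mathlib

section
/- Let m, n be integers with 1 ≤ m < n ≤ 2m. Alice has a winning strategy in the achievement game (S_{m,n}, K_{2n, 2m+1}, +), played on the complete bipartite graph with parts of sizes 2n and 2m+1. -/
namespace AchievementGame

/-- A strategy for the achievement game: given the history of all moves played so far
(earliest first), produce the next move (an edge, i.e. an element of `Sym2`). -/
def Strategy (α : Type*) : Type _ := List (Sym2 α) → Sym2 α

/-- A strategy is valid for the host graph `G` if, whenever some edge of `G` is still
uncolored, it chooses an uncolored edge of `G`. -/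
def Strategy.Valid {α : Type*} (G : SimpleGraph α) (s : Strategy α) : Prop :=
  ∀ l : List (Sym2 α), (∃ e ∈ G.edgeSet, e ∉ l) → s l ∈ G.edgeSet ∧ s l ∉ l

/-- The history of the first `n` moves when Alice plays strategy `σ` and Bob plays
strategy `τ`; Alice moves first and the players alternate. -/
def hist {α : Type*} (σ τ : Strategy α) : ℕ → List (Sym2 α)
  | 0 => []
  | n + 1 => hist σ τ n ++ [(if n % 2 = 0 then σ else τ) (hist σ τ n)]

/-- The `n`-th move (0-indexed): even indices are Alice's (blue) moves,
odd indices are Bob's (red) moves. -/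
def move {α : Type*} (σ τ : Strategy α) (n : ℕ) : Sym2 α :=
  (if n % 2 = 0 then σ else τ) (hist σ τ n)

/-- The set `s` of edges contains a copy of the graph `F`. -/
def HasCopy {α β : Type*} (F : SimpleGraph β) (s : Set (Sym2 α)) : Prop :=
  ∃ f : β ↪ α, ∀ a b, F.Adj a b → s(f a, f b) ∈ s

/-- Alice has a winning strategy in the achievement game `(F, G, +)`: Alice has a valid
strategy such that against every valid strategy of Bob, at some legal move of Alice
(her `(k+1)`-st move, which exists since `2k+1 ≤ |E(G)|`) the blue edges contain a copy
of `F`, while the red edges played strictly before do not. -/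
def AliceWins {α β : Type*} (F : SimpleGraph β) (G : SimpleGraph α) : Prop :=
  ∃ σ : Strategy α, Strategy.Valid G σ ∧ ∀ τ : Strategy α, Strategy.Valid G τ →
    ∃ k : ℕ, 2 * k + 1 ≤ G.edgeSet.ncard ∧
      HasCopy F {e | ∃ i ≤ k, e = move σ τ (2 * i)} ∧
      ¬ HasCopy F {e | ∃ i < k, e = move σ τ (2 * i + 1)}

/-- The matching `mK₂` consisting of `m` pairwise disjoint edges. -/
def matching (m : ℕ) : SimpleGraph (Fin m ⊕ Fin m) :=
  SimpleGraph.fromRel (fun a b => ∃ i, a = Sum.inl i ∧ b = Sum.inr i)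

/-- The star `K_{1,m}`: the center `0` joined to `m` leaves. -/
def star (m : ℕ) : SimpleGraph (Fin (m + 1)) :=
  SimpleGraph.fromRel (fun a _ => a = 0)

/-- The double star `S_{m,n}`: disjoint stars `K_{1,m}` and `K_{1,n}` with an edge
joining their centers `Sum.inl 0` and `Sum.inr 0`. -/
def doubleStar (m n : ℕ) : SimpleGraph (Fin (m + 1) ⊕ Fin (n + 1)) :=
  SimpleGraph.fromRel (fun a b =>
    (a = Sum.inl 0 ∧ ∃ i, b = Sum.inl i) ∨
    (a = Sum.inr 0 ∧ ∃ j, b = Sum.inr j) ∨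
    (a = Sum.inl 0 ∧ b = Sum.inr 0))

/-- The disjoint union `K_{1,m} ∪ nK₂` of a star and a matching. -/
def starMatching (m n : ℕ) : SimpleGraph (Fin (m + 1) ⊕ (Fin n ⊕ Fin n)) :=
  SimpleGraph.fromRel (fun a b =>
    (a = Sum.inl 0 ∧ ∃ i, b = Sum.inl i) ∨
    (∃ i, a = Sum.inr (Sum.inl i) ∧ b = Sum.inr (Sum.inr i)))

end AchievementGame

open AchievementGame

namespace DS

open Finset

abbrev Cell (m n : ℕ) := Fin (2 * n) × Fin (2 * m + 1)

variable {m n : ℕ}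

/-- number of elements of `S` on the line `A` -/
def cnt (A S : Finset (Cell m n)) : ℕ := (S ∩ A).card

def rowS (x : Fin (2 * n)) : Finset (Cell m n) := univ.filter (fun e => e.1 = x)
def colS (y : Fin (2 * m + 1)) : Finset (Cell m n) := univ.filter (fun e => e.2 = y)
def outS (C : Finset (Fin (2 * m + 1))) (x : Fin (2 * n)) : Finset (Cell m n) :=
  univ.filter (fun e => e.1 = x ∧ e.2 ∉ C)

@[simp] lemma mem_rowS (x : Fin (2 * n)) (e : Cell m n) : e ∈ rowS x ↔ e.1 = x := by simp [rowS]
@[simp] lemma mem_colS (y : Fin (2 * m + 1)) (e : Cell m n) : e ∈ colS y ↔ e.2 = y := by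
  simp [colS]
@[simp] lemma mem_outS (C : Finset (Fin (2 * m + 1))) (x : Fin (2 * n)) (e : Cell m n) :
    e ∈ outS C x ↔ e.1 = x ∧ e.2 ∉ C := by simp [outS]

lemma card_rowS (x : Fin (2 * n)) : (rowS x : Finset (Cell m n)).card = 2 * m + 1 := by
  have : (rowS x : Finset (Cell m n)) = {x} ×ˢ univ := by
    ext ⟨a, b⟩; simp only [mem_rowS, mem_product, mem_singleton, mem_univ, and_true]
  rw [this, card_product]; simp

lemma card_colS (y : Fin (2 * m + 1)) : (colS y : Finset (Cell m n)).card = 2 * n := by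
  have : (colS y : Finset (Cell m n)) = univ ×ˢ {y} := by
    ext ⟨a, b⟩; simp only [mem_colS, mem_product, mem_singleton, mem_univ, true_and]
  rw [this, card_product]; simp

lemma card_outS (C : Finset (Fin (2 * m + 1))) (x : Fin (2 * n)) :
    (outS C x : Finset (Cell m n)).card + C.card = 2 * m + 1 := by
  have : (outS C x : Finset (Cell m n)) = {x} ×ˢ Cᶜ := by
    ext ⟨a, b⟩; simp only [mem_outS, mem_product, mem_singleton, mem_compl]
  rw [this, card_product, card_compl]
  have := card_le_univ C
  simp at this ⊢; omega

lemma cnt_insert {A S : Finset (Cell m n)} {e : Cell m n} (h : e ∉ S) :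
    cnt A (insert e S) = cnt A S + if e ∈ A then 1 else 0 := by
  unfold cnt
  split_ifs with hA
  · rw [insert_inter_of_mem hA, card_insert_of_notMem (by simp [h])]
  · rw [insert_inter_of_notMem hA]; simp

lemma cnt_le {A B R : Finset (Cell m n)} (h : Disjoint B R) : cnt A B + cnt A R ≤ A.card := by
  unfold cnt
  rw [← card_union_of_disjoint (disjoint_of_subset_left inter_subset_left
    (disjoint_of_subset_right inter_subset_left h))]
  apply card_le_card
  intro e; simp; tauto

lemma exists_free {A B R : Finset (Cell m n)} (h : cnt A B + cnt A R < A.card) :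
    ∃ e ∈ A, e ∉ B ∧ e ∉ R := by
  by_contra hc
  push Not at hc
  have : A ⊆ (B ∩ A) ∪ (R ∩ A) := by
    intro e he
    by_cases hb : e ∈ B
    · simp [hb, he]
    · simp [hc e he hb, he]
  have h1 := card_le_card this
  have h2 := card_union_le (B ∩ A) (R ∩ A)
  unfold cnt at h; omega

lemma row_le (C : Finset (Fin (2 * m + 1))) (x : Fin (2 * n)) (S : Finset (Cell m n)) :
    cnt (rowS x) S ≤ C.card + cnt (outS C x) S := by
  unfold cnt
  have : S ∩ rowS x ⊆ (C.image (fun c => (x, c))) ∪ (S ∩ outS C x) := by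
    rintro ⟨a, b⟩
    simp
    rintro h rfl
    by_cases hb : b ∈ C <;> simp [hb, h]
  have h1 := card_le_card this
  have h2 := card_union_le (C.image (fun c => (x, c))) (S ∩ outS C x)
  have h3 : (C.image (fun c => (x, c))).card ≤ C.card := card_image_le
  omega

lemma col_le (T : Finset (Fin (2 * n))) (y : Fin (2 * m + 1)) (S : Finset (Cell m n))
    (h : ∀ e ∈ S, e.2 = y → e.1 ∈ T) : cnt (colS y) S ≤ T.card := by
  unfold cnt
  apply card_le_card_of_injOn (fun e => e.1)
  · intro e he
    simp at he
    exact h e he.1 he.2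
  · rintro ⟨a, b⟩ h1 ⟨c, d⟩ h2 h3
    simp at h1 h2 h3
    ext <;> simp [h1, h2, h3]

lemma row_le' (T : Finset (Fin (2 * m + 1))) (x : Fin (2 * n)) (S : Finset (Cell m n))
    (h : ∀ e ∈ S, e.1 = x → e.2 ∈ T) : cnt (rowS x) S ≤ T.card := by
  unfold cnt
  apply card_le_card_of_injOn (fun e => e.2)
  · intro e he
    simp at he
    exact h e he.1 he.2
  · rintro ⟨a, b⟩ h1 ⟨c, d⟩ h2 h3
    simp at h1 h2 h3
    ext <;> simp [h1, h2, h3]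

lemma le_row (T : Finset (Fin (2 * m + 1))) (x : Fin (2 * n)) (S : Finset (Cell m n))
    (h : ∀ c ∈ T, (x, c) ∈ S) : T.card ≤ cnt (rowS x) S := by
  unfold cnt
  apply card_le_card_of_injOn (fun c => (x, c))
  · intro c hc
    simpa using h c hc
  · intro a _ b _ h; simpa using h

lemma le_col (T : Finset (Fin (2 * n))) (y : Fin (2 * m + 1)) (S : Finset (Cell m n))
    (h : ∀ c ∈ T, (c, y) ∈ S) : T.card ≤ cnt (colS y) S := by
  unfold cnt
  apply card_le_card_of_injOn (fun c => (c, y))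
  · intro c hc
    simpa using h c hc
  · intro a _ b _ h; simpa using h

lemma cnt_le_card (A S : Finset (Cell m n)) : cnt A S ≤ S.card := card_le_card inter_subset_left

/-- a double star in the set `S` of cells -/
def Good (S : Finset (Cell m n)) : Prop :=
  ∃ x y, (x, y) ∈ S ∧ ((m + 1 ≤ cnt (rowS x) S ∧ n + 1 ≤ cnt (colS y) S) ∨
    (n + 1 ≤ cnt (rowS x) S ∧ m + 1 ≤ cnt (colS y) S))

lemma Good.card_le {S : Finset (Cell m n)} (h : Good S) : n + m + 1 ≤ S.card := by
  obtain ⟨x, y, -, h⟩ := h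
  have h1 : (S ∩ rowS x) ∪ (S ∩ colS y) ⊆ S := by
    intro e; simp; tauto
  have h2 : (S ∩ rowS x) ∩ (S ∩ colS y) ⊆ {(x, y)} := by
    rintro ⟨a, b⟩; simp; tauto
  have h3 := card_le_card h1
  have h4 := card_le_card h2
  have h5 := card_union_add_card_inter (S ∩ rowS x) (S ∩ colS y)
  rw [card_singleton] at h4
  unfold cnt at h
  omega

lemma not_good {S : Finset (Cell m n)} (hr : ∀ x, cnt (rowS x) S ≤ n)
    (hc : ∀ y, cnt (colS y) S ≤ n) : ¬ Good S := by
  rintro ⟨x, y, -, h⟩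
  have := hr x
  have := hc y
  omega

/-- Alice (blue, `B`), to move, wins. -/
inductive W : Finset (Cell m n) → Finset (Cell m n) → Prop
  | win (B R : Finset (Cell m n)) (e : Cell m n) (hB : e ∉ B) (hR : e ∉ R)
      (h : Good (insert e B)) : W B R
  | step (B R : Finset (Cell m n)) (e : Cell m n) (hB : e ∉ B) (hR : e ∉ R)
      (h1 : ∀ f, f ∉ insert e B → f ∉ R → ¬ Good (insert f R))
      (h2 : ∀ f, f ∉ insert e B → f ∉ R → W (insert e B) (insert f R)) : W B R

/-- Bob to move, Alice wins. -/
def V (B R : Finset (Cell m n)) : Prop :=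
  ∀ f, f ∉ B → f ∉ R → ¬ Good (insert f R) ∧ W B (insert f R)

lemma W.mk {B R : Finset (Cell m n)} {e : Cell m n} (hB : e ∉ B) (hR : e ∉ R)
    (h : V (insert e B) R) : W B R :=
  W.step B R e hB hR (fun f h1 h2 => (h f h1 h2).1) (fun f h1 h2 => (h f h1 h2).2)

/-- No-waste lemma. -/
lemma noWaste (x : Fin (2 * n)) (y : Fin (2 * m + 1)) (N : ℕ) :
    ∀ (B R : Finset (Cell m n)) (a b : ℕ), a + b = N + 1 → Disjoint B R → R.card = B.card →
    (x, y) ∈ B →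
    ((m + 1 ≤ cnt (rowS x) B + a ∧ n + 1 ≤ cnt (colS y) B + b) ∨
      (n + 1 ≤ cnt (rowS x) B + a ∧ m + 1 ≤ cnt (colS y) B + b)) →
    ((2 * a + cnt (rowS x) B + cnt (rowS x) R ≤ 2 * m + 2 ∧
      2 * b + cnt (colS y) B + cnt (colS y) R ≤ 2 * n) ∨
     (2 * a + cnt (rowS x) B + cnt (rowS x) R ≤ 2 * m + 1 ∧
      2 * b + cnt (colS y) B + cnt (colS y) R ≤ 2 * n + 1)) →
    B.card + a + b ≤ n + m + 1 → W B R := by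
  induction N with
  | zero =>
    intro B R a b hab hd hc hxy ht hp hn
    have key : ∃ e, e ∉ B ∧ e ∉ R ∧ ((a = 1 ∧ e ∈ rowS x) ∨ (b = 1 ∧ e ∈ colS y)) := by
      rcases Nat.eq_zero_or_pos a with h0 | h0
      · obtain ⟨e, h1, h2, h3⟩ := exists_free (A := colS y) (B := B) (R := R)
          (by rw [card_colS]; omega)
        exact ⟨e, h2, h3, Or.inr ⟨by omega, h1⟩⟩
      · obtain ⟨e, h1, h2, h3⟩ := exists_free (A := rowS x) (B := B) (R := R)
          (by rw [card_rowS]; omega)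
        exact ⟨e, h2, h3, Or.inl ⟨by omega, h1⟩⟩
    obtain ⟨e, h1, h2, h3⟩ := key
    refine W.win B R e h1 h2 ⟨x, y, by simp [hxy], ?_⟩
    rw [cnt_insert h1, cnt_insert h1]
    rcases h3 with ⟨h3, h4⟩ | ⟨h3, h4⟩ <;> rw [if_pos h4] <;> omega
  | succ N ih =>
    intro B R a b hab hd hc hxy ht hp hn
    have hr := cnt_le (A := rowS x) hd
    have hcc := cnt_le (A := colS y) hd
    rw [card_rowS] at hr
    rw [card_colS] at hcc
    have key : ∃ e a' b', e ∉ B ∧ e ∉ R ∧ ((a = a' + 1 ∧ b = b' ∧ e ∈ rowS x ∧ e ∉ colS y) ∨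
        (b = b' + 1 ∧ a = a' ∧ e ∈ colS y ∧ e ∉ rowS x)) ∧
        2 * a' + cnt (rowS x) (insert e B) + cnt (rowS x) R ≤ 2 * m + 1 ∧
        2 * b' + cnt (colS y) (insert e B) + cnt (colS y) R ≤ 2 * n := by
      by_cases h0 : 0 < a ∧ 2 * b + cnt (colS y) B + cnt (colS y) R ≤ 2 * n
      · obtain ⟨e, h1, h2, h3⟩ := exists_free (A := rowS x) (B := B) (R := R)
          (by rw [card_rowS]; omega)
        have h4 : e ∉ colS y := by
          intro h4
          simp at h1 h4
          apply h2
          have : e = (x, y) := by ext <;> simp [h1, h4]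
          rw [this]; exact hxy
        refine ⟨e, a - 1, b, h2, h3, Or.inl ⟨by omega, rfl, h1, h4⟩, ?_, ?_⟩
        · rw [cnt_insert h2, if_pos h1]; omega
        · rw [cnt_insert h2, if_neg h4]; omega
      · obtain ⟨e, h1, h2, h3⟩ := exists_free (A := colS y) (B := B) (R := R)
          (by rw [card_colS]; omega)
        have h4 : e ∉ rowS x := by
          intro h4
          simp at h1 h4
          apply h2
          have : e = (x, y) := by ext <;> simp [h1, h4]
          rw [this]; exact hxy
        refine ⟨e, a, b - 1, h2, h3, Or.inr ⟨by omega, rfl, h1, h4⟩, ?_, ?_⟩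
        · rw [cnt_insert h2, if_neg h4]; omega
        · rw [cnt_insert h2, if_pos h1]; omega
    obtain ⟨e, a', b', h1, h2, h3, h4, h5⟩ := key
    apply W.mk h1 h2
    intro f hf1 hf2
    have hBc := card_insert_of_notMem h1
    have hRc := card_insert_of_notMem hf2
    have hxy' : (x, y) ∈ insert e B := by simp [hxy]
    constructor
    · intro hg
      have := hg.card_le
      omega
    · apply ih (insert e B) (insert f R) a' b'
      · omega
      · rw [disjoint_insert_right, disjoint_insert_left]
        exact ⟨hf1, h2, hd⟩
      · omega
      · exact hxy'
      · rw [cnt_insert h1, cnt_insert h1]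
        rcases h3 with ⟨h3, h6, h7, h8⟩ | ⟨h3, h6, h7, h8⟩ <;> rw [if_pos h7, if_neg h8] <;> omega
      · have : ¬ (f ∈ rowS x ∧ f ∈ colS y) := by
          rintro ⟨h7, h8⟩
          simp at h7 h8
          apply hf1
          have : f = (x, y) := by ext <;> simp [h7, h8]
          rw [this]; exact hxy'
        rw [cnt_insert hf2, cnt_insert hf2]
        by_cases h7 : f ∈ rowS x
        · have h8 : f ∉ colS y := fun h8 => this ⟨h7, h8⟩
          rw [if_pos h7, if_neg h8]; omega
        · rw [if_neg h7]
          split_ifs <;> omega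
      · omega

def Fr (B R : Finset (Cell m n)) : Finset (Cell m n) := univ.filter (fun e => e ∉ B ∧ e ∉ R)

lemma Fr_left {B R : Finset (Cell m n)} {e : Cell m n} (h1 : e ∉ B) (h2 : e ∉ R) :
    (Fr (insert e B) R).card < (Fr B R).card := by
  apply card_lt_card
  rw [ssubset_iff_of_subset]
  · exact ⟨e, by simp [Fr, h1, h2], by simp [Fr]⟩
  · intro f; simp [Fr]; tauto

lemma Fr_right {B R : Finset (Cell m n)} {e : Cell m n} (h1 : e ∉ B) (h2 : e ∉ R) :
    (Fr B (insert e R)).card < (Fr B R).card := by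
  apply card_lt_card
  rw [ssubset_iff_of_subset]
  · exact ⟨e, by simp [Fr, h1, h2], by simp [Fr]⟩
  · intro f; simp [Fr]; tauto

lemma disj_insert {B R : Finset (Cell m n)} {e f : Cell m n} (hd : Disjoint B R)
    (he : e ∉ insert f R) (hf : f ∉ B) : Disjoint (insert e B) (insert f R) := by
  rw [disjoint_insert_left, disjoint_insert_right]
  exact ⟨he, hf, hd⟩

/-- A free answer in a balanced column. -/
lemma col_answer {B R : Finset (Cell m n)} {f : Cell m n} (hd : Disjoint B R)
    (hfB : f ∉ B) (hfR : f ∉ R) (hb : cnt (colS f.2) R = cnt (colS f.2) B) :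
    ∃ e : Cell m n, e.2 = f.2 ∧ e ∉ B ∧ e ∉ insert f R := by
  have h1 : Disjoint B (insert f R) := by
    rw [disjoint_insert_right]; exact ⟨hfB, hd⟩
  have h2 := cnt_le (A := colS f.2) h1
  rw [card_colS] at h2
  have h3 : cnt (colS f.2) (insert f R) = cnt (colS f.2) R + 1 := by
    rw [cnt_insert hfR, if_pos (by simp)]
  obtain ⟨e, he, h4, h5⟩ := exists_free (A := colS f.2) (B := B) (R := insert f R)
    (by rw [card_colS]; omega)
  exact ⟨e, by simpa using he, h4, h5⟩

/-- Red counts in a balanced column stay small. -/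
lemma col_small {B R : Finset (Cell m n)} {f : Cell m n} {c : Fin (2 * m + 1)}
    (hd : Disjoint B R) (hfB : f ∉ B) (hfR : f ∉ R) (hb : cnt (colS c) R = cnt (colS c) B) :
    cnt (colS c) (insert f R) ≤ n := by
  have h1 : Disjoint B (insert f R) := by
    rw [disjoint_insert_right]; exact ⟨hfB, hd⟩
  have h2 := cnt_le (A := colS c) h1
  rw [card_colS] at h2
  rw [cnt_insert hfR] at h2 ⊢
  split_ifs at h2 ⊢ <;> omega

/-- Balancedness is preserved. -/
lemma bal_answer {B R : Finset (Cell m n)} {e f : Cell m n} {c : Fin (2 * m + 1)}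
    (heB : e ∉ B) (hfR : f ∉ R) (h : e.2 = f.2) (hb : cnt (colS c) R = cnt (colS c) B) :
    cnt (colS c) (insert f R) = cnt (colS c) (insert e B) := by
  rw [cnt_insert heB, cnt_insert hfR, hb]
  simp [h]

lemma cnt_mono (A : Finset (Cell m n)) {S S' : Finset (Cell m n)} (h : S ⊆ S') :
    cnt A S ≤ cnt A S' := card_le_card (inter_subset_inter_right h)

structure PInv (x0 : Fin (2 * n)) (y : Fin (2 * m + 1)) (C : Finset (Fin (2 * m + 1)))
    (T : Finset (Fin (2 * n))) (t : Fin (2 * n)) (y0 : Fin (2 * m + 1)) (r1 : Fin (2 * n))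
    (B R : Finset (Cell m n)) : Prop where
  disj : Disjoint B R
  lead : (x0, y) ∈ B
  row0 : m + 1 ≤ cnt (rowS x0) B
  yC : y ∉ C
  bal : ∀ c ∈ C, cnt (colS c) R = cnt (colS c) B
  outN : ∀ r, r ∉ T → cnt (outS C r) R ≤ cnt (outS C r) B
  outT : ∀ r ∈ T, cnt (outS C r) R ≤ cnt (outS C r) B + 1 ∨
    (cnt (outS C r) R + cnt (outS C r) B + C.card = 2 * m + 1 ∧
      cnt (outS C r) R ≤ cnt (outS C r) B + 2)
  red : ∀ e ∈ R, e.2 ∉ C → e.1 ∈ T ∨ (e.2 = y0 ∧ e.1 = r1)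
  big : T.card + 1 ≤ cnt (colS y) B
  small : cnt (colS y) B ≤ n
  tT : t ∈ T
  tB : (t, y) ∈ B
  tB0 : (t, y0) ∈ B
  r1B : (r1, y) ∈ B
  hC : C.card + 2 + 2 * m ≤ 2 * n

lemma PInv.v {x0 : Fin (2 * n)} {y : Fin (2 * m + 1)} {C : Finset (Fin (2 * m + 1))}
    {t : Fin (2 * n)} {y0 : Fin (2 * m + 1)} {r1 : Fin (2 * n)} (N : ℕ) :
    ∀ (T : Finset (Fin (2 * n))) (B R : Finset (Cell m n)), (Fr B R).card < N →
      PInv x0 y C T t y0 r1 B R → V B R := by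
  induction N with
  | zero => intro T B R h; omega
  | succ N ih =>
  intro T B R hN P f hfB hfR
  have hdf : Disjoint B (insert f R) := by
    rw [disjoint_insert_right]; exact ⟨hfB, P.disj⟩
  have hTc := card_insert_le f.1 T
  have hrows : ∀ r, cnt (outS C r) (insert f R) ≤ cnt (outS C r) B + 2 := by
    intro r
    have h0 := cnt_le (A := outS C r) hdf
    have h1 := card_outS (n := n) C r
    rw [cnt_insert hfR] at h0 ⊢
    by_cases hr : r ∈ T
    · have := P.outT r hr
      split_ifs at h0 ⊢ <;> omega
    · have := P.outN r hr
      split_ifs at h0 ⊢ <;> omega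
  -- columns outside `C`
  have hred : ∀ e ∈ insert f R, e.2 ∉ C → e.1 ∈ insert f.1 T ∨ (e.2 = y0 ∧ e.1 = r1) := by
    intro e he hC
    rw [mem_insert] at he
    rcases he with rfl | he
    · left; simp
    · rcases P.red e he hC with h | h
      · left; simp [h]
      · right; exact h
  have htT : t ∈ insert f.1 T := by simp [P.tT]
  refine ⟨not_good ?_ ?_, ?_⟩
  · intro r
    have h0 := cnt_le (A := outS C r) hdf
    have h1 := card_outS (n := n) C r
    have h2 := row_le C r (insert f R)
    have h3 := hrows r
    have := P.hC
    omega
  · intro k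
    by_cases hk : k ∈ C
    · exact col_small P.disj hfB hfR (P.bal k hk)
    · have hs := P.small
      have hb := P.big
      by_cases hy : k = y0
      · have := col_le (insert r1 ((insert f.1 T).erase t)) k (insert f R) (by
          intro e he hek
          rcases hred e he (by rw [hek]; exact hk) with h | h
          · have : e.1 ≠ t := by
              intro het
              have h5 : e = (t, y0) := by ext <;> simp [het, hek, hy]
              exact disjoint_left.1 hdf P.tB0 (h5 ▸ he)
            exact mem_insert_of_mem (mem_erase.2 ⟨this, h⟩)
          · simp [h.2])
        have h2 := card_insert_le r1 ((insert f.1 T).erase t)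
        have h3 := card_erase_add_one htT
        omega
      · have := col_le (insert f.1 T) k (insert f R) (by
          intro e he hek
          rcases hred e he (by rw [hek]; exact hk) with h | h
          · exact h
          · exact absurd (hek.symm.trans h.1) hy)
        omega
  · -- the answer of Alice
    suffices key : ∃ e, e ∉ B ∧ e ∉ insert f R ∧ (cnt (colS y) (insert e B) ≤ n →
        ∃ T', PInv x0 y C T' t y0 r1 (insert e B) (insert f R)) by
      obtain ⟨e, h1, h2, h3⟩ := key
      by_cases h4 : cnt (colS y) (insert e B) ≤ n
      · obtain ⟨T', hT'⟩ := h3 h4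
        apply W.mk h1 h2
        apply ih T' _ _ _ hT'
        have := Fr_right hfB hfR
        have := Fr_left h1 h2
        omega
      · refine W.win _ _ e h1 h2 ⟨x0, y, by simp [P.lead], Or.inl ⟨?_, by omega⟩⟩
        exact P.row0.trans (cnt_mono _ (subset_insert _ _))
    by_cases hfC : f.2 ∈ C
    · obtain ⟨e, he, h1, h2⟩ := col_answer P.disj hfB hfR (P.bal _ hfC)
      refine ⟨e, h1, h2, fun hs => ⟨T, ?_⟩⟩
      have heo : ∀ r, e ∉ outS C r := by intro r; simp [he, hfC]
      have hfo : ∀ r, f ∉ outS C r := by intro r; simp [hfC]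
      refine ⟨disj_insert P.disj h2 hfB, by simp [P.lead],
        P.row0.trans (cnt_mono _ (subset_insert _ _)), P.yC, ?_, ?_, ?_, ?_, ?_, hs, P.tT,
        by simp [P.tB], by simp [P.tB0], by simp [P.r1B], P.hC⟩
      · intro c hc
        exact bal_answer h1 hfR he (P.bal c hc)
      · intro r hr
        rw [cnt_insert h1, cnt_insert hfR, if_neg (heo r), if_neg (hfo r)]
        exact P.outN r hr
      · intro r hr
        rw [cnt_insert h1, cnt_insert hfR, if_neg (heo r), if_neg (hfo r)]
        exact P.outT r hr
      · intro g hg hgC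
        rw [mem_insert] at hg
        rcases hg with rfl | hg
        · exact absurd hfC hgC
        · exact P.red g hg hgC
      · exact P.big.trans (cnt_mono _ (subset_insert _ _))
    · -- outside `C`
      have hbal : ∀ e : Cell m n, e ∉ B → e.2 ∉ C → ∀ c ∈ C,
          cnt (colS c) (insert f R) = cnt (colS c) (insert e B) := by
        intro e heB he c hc
        rw [cnt_insert heB, cnt_insert hfR, if_neg, if_neg]
        · exact P.bal c hc
        · rw [mem_colS]; rintro rfl; exact he hc
        · rw [mem_colS]; rintro rfl; exact hfC hc
      have hfin : f ∈ outS C f.1 := by simp [hfC]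
      by_cases hcase : f.1 ∈ T ∧ cnt (outS C f.1) B + cnt (outS C f.1) (insert f R) <
          (outS C f.1 : Finset (Cell m n)).card
      · obtain ⟨e, he, h1, h2⟩ := exists_free hcase.2
        refine ⟨e, h1, h2, fun hs => ⟨T, ?_⟩⟩
        refine ⟨disj_insert P.disj h2 hfB, by simp [P.lead],
          P.row0.trans (cnt_mono _ (subset_insert _ _)), P.yC,
          hbal e h1 (by simp at he; exact he.2), ?_, ?_, ?_, ?_, hs, P.tT,
          by simp [P.tB], by simp [P.tB0], by simp [P.r1B], P.hC⟩
        · intro r hr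
          have hne : f ∉ outS C r := by
            rw [mem_outS]; rintro ⟨rfl, -⟩; exact hr hcase.1
          rw [cnt_insert hfR, if_neg hne]
          exact (P.outN r hr).trans (cnt_mono _ (subset_insert _ _))
        · intro r hr
          by_cases hrf : r = f.1
          · subst hrf
            left
            have := hrows f.1
            rw [cnt_insert h1, if_pos he]
            omega
          · have hne : f ∉ outS C r := by
              rw [mem_outS]; rintro ⟨rfl, -⟩; exact hrf rfl
            have hne' : e ∉ outS C r := by
              rw [mem_outS] at he ⊢; rintro ⟨rfl, -⟩; exact hrf he.1
            rw [cnt_insert hfR, if_neg hne, cnt_insert h1, if_neg hne']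
            exact P.outT r hr
        · intro g hg hgC
          have := hred g hg hgC
          rwa [insert_eq_of_mem hcase.1] at this
        · exact P.big.trans (cnt_mono _ (subset_insert _ _))
      · -- answer in column `y`
        have hcy := col_le ((insert f.1 T).erase t) y (insert f R) (by
          intro g hg hgy
          have hgt : g.1 ≠ t := by
            intro h
            have : g = (t, y) := by ext <;> simp [h, hgy]
            exact disjoint_left.1 hdf P.tB (this ▸ hg)
          refine mem_erase.2 ⟨hgt, ?_⟩
          rcases hred g hg (by rw [hgy]; exact P.yC) with h | h
          · exact h
          · have : g = (r1, y) := by ext <;> simp [h.2, hgy]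
            exact absurd (this ▸ hg) (disjoint_left.1 hdf P.r1B))
        have h3 := card_erase_add_one htT
        have hbig := P.big
        have hsm := P.small
        obtain ⟨e, he, h1, h2⟩ := exists_free (A := colS y) (B := B) (R := insert f R)
          (by rw [card_colS]; omega)
        have he2 : e.2 = y := by simpa using he
        refine ⟨e, h1, h2, fun hs => ⟨insert f.1 T, ?_⟩⟩
        refine ⟨disj_insert P.disj h2 hfB, by simp [P.lead],
          P.row0.trans (cnt_mono _ (subset_insert _ _)), P.yC,
          hbal e h1 (by rw [he2]; exact P.yC), ?_, ?_, hred, ?_, hs, htT,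
          by simp [P.tB], by simp [P.tB0], by simp [P.r1B], P.hC⟩
        · intro r hr
          rw [mem_insert, not_or] at hr
          have hne : f ∉ outS C r := by
            rw [mem_outS]; rintro ⟨rfl, -⟩; exact hr.1 rfl
          rw [cnt_insert hfR, if_neg hne]
          exact (P.outN r hr.2).trans (cnt_mono _ (subset_insert _ _))
        · intro r hr
          have h0 := cnt_le (A := outS C r) (disj_insert P.disj h2 hfB)
          have hco := card_outS (n := n) C r
          have hmono := cnt_mono (outS C r) (subset_insert e B)
          by_cases hrf : r = f.1
          · subst hrf
            by_cases hT : f.1 ∈ T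
            · right
              have := hrows f.1
              have : ¬ _ := fun h => hcase ⟨hT, h⟩
              omega
            · left
              rw [cnt_insert hfR, if_pos hfin]
              have := P.outN _ hT
              omega
          · have hne : f ∉ outS C r := by
              rw [mem_outS]; rintro ⟨rfl, -⟩; exact hrf rfl
            have hrT : r ∈ T := by
              rw [mem_insert] at hr; exact hr.resolve_left hrf
            rw [cnt_insert hfR, if_neg hne] at h0 ⊢
            have := P.outT r hrT
            omega
        · rw [cnt_insert h1, if_pos he]
          omega

/-- cells outside the columns in `C` -/
def oS (C : Finset (Fin (2 * m + 1))) : Finset (Cell m n) := univ.filter (fun e => e.2 ∉ C)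

@[simp] lemma mem_oS (C : Finset (Fin (2 * m + 1))) (e : Cell m n) : e ∈ oS C ↔ e.2 ∉ C := by
  simp [oS]

lemma cnt_mono_left {A A' : Finset (Cell m n)} (S : Finset (Cell m n)) (h : A ⊆ A') :
    cnt A S ≤ cnt A' S := card_le_card (inter_subset_inter_left h)

lemma cnt_eq_zero {A S : Finset (Cell m n)} (h : ∀ e ∈ S, e ∉ A) : cnt A S = 0 := by
  unfold cnt
  rw [card_eq_zero, eq_empty_iff_forall_notMem]
  intro e he
  rw [mem_inter] at he
  exact h e he.1 he.2

lemma cnt_le_one {A S : Finset (Cell m n)} (g : Cell m n) (h : ∀ e ∈ S, e ∈ A → e = g) :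
    cnt A S ≤ 1 := by
  unfold cnt
  refine card_le_one.2 ?_
  intro a ha b hb
  rw [mem_inter] at ha hb
  rw [h a ha.1 ha.2, h b hb.1 hb.2]

lemma cnt_pos {A S : Finset (Cell m n)} {g : Cell m n} (h : g ∈ S) (hA : g ∈ A) :
    1 ≤ cnt A S := by
  unfold cnt
  exact card_pos.2 ⟨g, mem_inter.2 ⟨h, hA⟩⟩

lemma red_check {B R : Finset (Cell m n)} {C : Finset (Fin (2 * m + 1))} {f : Cell m n}
    (hd : Disjoint B R) (hfB : f ∉ B) (hfR : f ∉ R)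
    (bal : ∀ c ∈ C, cnt (colS c) R = cnt (colS c) B)
    (ho : C.card + cnt (oS C) R + 1 ≤ n) : ¬ Good (insert f R) := by
  have h0 : cnt (oS C) (insert f R) ≤ cnt (oS C) R + 1 := by
    rw [cnt_insert hfR]; split_ifs <;> omega
  apply not_good
  · intro r
    have h1 := row_le C r (insert f R)
    have h2 : cnt (outS C r) (insert f R) ≤ cnt (oS C) (insert f R) :=
      cnt_mono_left _ (by intro e; simp)
    omega
  · intro k
    by_cases hk : k ∈ C
    · exact col_small hd hfB hfR (bal k hk)
    · have h2 : cnt (colS k) (insert f R) ≤ cnt (oS C) (insert f R) :=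
        cnt_mono_left _ (by intro e; simp; rintro rfl; exact hk)
      omega

/-- the race in row `x0` -/
lemma race (x0 : Fin (2 * n)) (C : Finset (Fin (2 * m + 1))) (c1 : Fin (2 * m + 1)) (hc1 : c1 ∈ C)
    (hC : C.card + 2 + 2 * m ≤ 2 * n) (N : ℕ) :
    ∀ (a : ℕ) (B R : Finset (Cell m n)), (Fr B R).card < N → Disjoint B R →
      (∀ c ∈ C, (x0, c) ∈ B) → (∀ c ∈ C, cnt (colS c) R = cnt (colS c) B) →
      m + 1 ≤ cnt (colS c1) B → n + 1 ≤ cnt (rowS x0) B + a → 1 ≤ a →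
      2 * a + cnt (rowS x0) B + cnt (rowS x0) R ≤ 2 * m + 1 →
      cnt (oS C) R + a + n ≤ 2 * m + 2 → V B R := by
  induction N with
  | zero => intro a B R h; omega
  | succ N ih =>
  intro a B R hN hd hx0 bal hdeep hrow ha hfree ho f hfB hfR
  refine ⟨red_check hd hfB hfR bal (by omega), ?_⟩
  by_cases hfC : f.2 ∈ C
  · obtain ⟨e, he, h1, h2⟩ := col_answer hd hfB hfR (bal _ hfC)
    have hnr : ∀ g : Cell m n, g ∉ B → g.2 ∈ C → g ∉ rowS x0 := by
      intro g hg hgC hgr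
      rw [mem_rowS] at hgr
      apply hg
      have := hx0 _ hgC
      rwa [← hgr] at this
    apply W.mk h1 h2
    have := Fr_right hfB hfR
    have := Fr_left h1 h2
    have e1 : cnt (rowS x0) (insert e B) = cnt (rowS x0) B := by
      rw [cnt_insert h1, if_neg (hnr e h1 (by rw [he]; exact hfC))]; rfl
    have e2 : cnt (rowS x0) (insert f R) = cnt (rowS x0) R := by
      rw [cnt_insert hfR, if_neg (hnr f hfB hfC)]; rfl
    have e3 : cnt (oS C) (insert f R) = cnt (oS C) R := by
      rw [cnt_insert hfR, if_neg (by simp [hfC])]; rfl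
    apply ih a _ _ (by omega) (disj_insert hd h2 hfB)
    · intro c hc; simp [hx0 c hc]
    · intro c hc; exact bal_answer h1 hfR he (bal c hc)
    · exact hdeep.trans (cnt_mono _ (subset_insert _ _))
    · omega
    · omega
    · omega
    · omega
  · have e2 : cnt (rowS x0) (insert f R) ≤ cnt (rowS x0) R + 1 := by
      rw [cnt_insert hfR]; split_ifs <;> omega
    obtain ⟨e, he, h1, h2⟩ := exists_free (A := rowS x0) (B := B) (R := insert f R)
      (by rw [card_rowS]; omega)
    have e1 : cnt (rowS x0) (insert e B) = cnt (rowS x0) B + 1 := by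
      rw [cnt_insert h1, if_pos he]
    by_cases h : a = 1
    · exact W.win _ _ e h1 h2 ⟨x0, c1, by simp [hx0 c1 hc1],
        Or.inr ⟨by omega, hdeep.trans (cnt_mono _ (subset_insert _ _))⟩⟩
    · apply W.mk h1 h2
      have := Fr_right hfB hfR
      have := Fr_left h1 h2
      have heC : e.2 ∉ C := by
        intro heC
        rw [mem_rowS] at he
        apply h1
        have := hx0 _ heC
        rwa [← he] at this
      have e3 : cnt (oS C) (insert f R) = cnt (oS C) R + 1 := by
        rw [cnt_insert hfR, if_pos (by simp [hfC])]
      apply ih (a - 1) _ _ (by omega) (disj_insert hd h2 hfB)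
      · intro c hc; simp [hx0 c hc]
      · intro c hc
        rw [cnt_insert h1, cnt_insert hfR, if_neg, if_neg]
        · exact bal c hc
        · rw [mem_colS]; rintro rfl; exact heC hc
        · rw [mem_colS]; rintro rfl; exact hfC hc
      · exact hdeep.trans (cnt_mono _ (subset_insert _ _))
      · omega
      · omega
      · omega
      · omega

/-- Final lead state, Bob to move. -/
lemma final_lead (x0 : Fin (2 * n)) (C : Finset (Fin (2 * m + 1))) (c1 : Fin (2 * m + 1))
    (hc1 : c1 ∈ C) (y y2 : Fin (2 * m + 1)) (r1 : Fin (2 * n)) (hyC : y ∉ C) (hy2C : y2 ∉ C)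
    (hyy : y2 ≠ y) (hC : C.card + 2 + 2 * m = 2 * n) (hCm : m ≤ C.card)
    (hm : 1 ≤ m) (hmn : m < n) (hn : n ≤ 2 * m) (N : ℕ) :
    ∀ (B R : Finset (Cell m n)), (Fr B R).card < N → Disjoint B R →
      (∀ c ∈ C, (x0, c) ∈ B) → (∀ c ∈ C, cnt (colS c) R = cnt (colS c) B) →
      m + 1 ≤ cnt (colS c1) B → (x0, y) ∈ B → (x0, y2) ∈ B → (r1, y) ∈ R →
      (∀ e ∈ B, e.2 ∈ C ∨ e = (x0, y) ∨ e = (x0, y2)) →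
      (∀ e ∈ R, e.2 ∈ C ∨ e = (r1, y)) → V B R := by
  induction N with
  | zero => intro B R h; omega
  | succ N ih =>
  intro B R hN hd hx0 bal hdeep hxy hxy2 hr1 hB hR f hfB hfR
  have ho : cnt (oS C) R ≤ 1 := cnt_le_one (r1, y) (by
    intro e he heC
    rw [mem_oS] at heC
    exact (hR e he).resolve_left heC)
  have hr1x : r1 ≠ x0 := by
    rintro rfl
    exact disjoint_left.1 hd hxy hr1
  refine ⟨red_check hd hfB hfR bal (by omega), ?_⟩
  by_cases hfC : f.2 ∈ C
  · obtain ⟨e, he, h1, h2⟩ := col_answer hd hfB hfR (bal _ hfC)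
    apply W.mk h1 h2
    have := Fr_right hfB hfR
    have := Fr_left h1 h2
    apply ih _ _ (by omega) (disj_insert hd h2 hfB)
    · intro c hc; simp [hx0 c hc]
    · intro c hc; exact bal_answer h1 hfR he (bal c hc)
    · exact hdeep.trans (cnt_mono _ (subset_insert _ _))
    · simp [hxy]
    · simp [hxy2]
    · simp [hr1]
    · intro g hg
      rw [mem_insert] at hg
      rcases hg with rfl | hg
      · left; rw [he]; exact hfC
      · exact hB g hg
    · intro g hg
      rw [mem_insert] at hg
      rcases hg with rfl | hg
      · left; exact hfC
      · exact hR g hg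
  · have hrowB : C.card + 2 ≤ cnt (rowS x0) B := by
      have h1 : (insert y2 (insert y C)).card = C.card + 2 := by
        rw [card_insert_of_notMem (by simp [hyy, hy2C]), card_insert_of_notMem hyC]
      rw [← h1]
      apply le_row
      intro c hc
      rw [mem_insert, mem_insert] at hc
      rcases hc with rfl | rfl | hc
      · exact hxy2
      · exact hxy
      · exact hx0 c hc
    by_cases hfx : f.1 = x0
    · have h1 : ((r1, y2) : Cell m n) ∉ B := by
        intro h
        rcases hB _ h with h | h | h
        · exact hy2C h
        · exact hr1x (congrArg Prod.fst h)
        · exact hr1x (congrArg Prod.fst h)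
      have h2 : ((r1, y2) : Cell m n) ∉ insert f R := by
        intro h
        rw [mem_insert] at h
        rcases h with h | h
        · exact hr1x (by rw [← hfx, ← h])
        · rcases hR _ h with h | h
          · exact hy2C h
          · exact hyy (congrArg Prod.snd h)
      apply W.mk h1 h2
      apply PInv.v (x0 := x0) (y := y2) (C := C) (t := x0) (y0 := y) (r1 := r1) _ {x0} _ _
        (Nat.lt_succ_self _)
      have hRo : ∀ r, r ≠ x0 → ∀ e ∈ insert f R, e ∈ outS C r → e = (r1, y) := by
        intro r hr e he ho
        rw [mem_outS] at ho
        rw [mem_insert] at he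
        rcases he with rfl | he
        · exact absurd (ho.1.symm.trans hfx) hr
        · exact (hR e he).resolve_left ho.2
      refine ⟨disj_insert hd h2 hfB, by simp [hxy2], ?_, hy2C, ?_, ?_, ?_, ?_, ?_, ?_, by simp,
        by simp [hxy2], by simp [hxy], by simp, by omega⟩
      · have := cnt_mono (rowS x0) (subset_insert (r1, y2) B)
        omega
      · intro c hc
        rw [cnt_insert h1, cnt_insert hfR, if_neg, if_neg]
        · exact bal c hc
        · rw [mem_colS]; rintro rfl; exact hy2C hc
        · rw [mem_colS]; rintro rfl; exact hfC hc
      · intro r hr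
        rw [mem_singleton] at hr
        by_cases hrr : r = r1
        · subst hrr
          calc _ ≤ 1 := cnt_le_one (r, y) (hRo r hr)
            _ ≤ _ := cnt_pos (g := (r, y2)) (by simp) (by simp [hy2C])
        · rw [cnt_eq_zero]
          · exact Nat.zero_le _
          · intro e he ho
            have := hRo r hr e he ho
            rw [mem_outS, this] at ho
            exact hrr ho.1.symm
      · intro r hr
        rw [mem_singleton] at hr
        subst hr
        left
        have : cnt (outS C r) (insert f R) ≤ 1 := cnt_le_one f (by
          intro e he ho
          rw [mem_outS] at ho
          rw [mem_insert] at he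
          rcases he with he | he
          · exact he
          · have := (hR e he).resolve_left ho.2
            rw [this] at ho
            exact absurd ho.1 hr1x)
        omega
      · intro e he heC
        rw [mem_insert] at he
        rcases he with rfl | he
        · left; simp [hfx]
        · right
          have := (hR e he).resolve_left heC
          rw [this]; exact ⟨rfl, rfl⟩
      · have h3 := le_col {x0, r1} y2 (insert (r1, y2) B) (by
          intro c hc
          rw [mem_insert, mem_singleton] at hc
          rcases hc with rfl | rfl
          · simp [hxy2]
          · simp)
        rw [card_pair hr1x.symm] at h3
        rw [card_singleton]; exact h3
      · have h3 := col_le {x0, r1} y2 (insert (r1, y2) B) (by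
          intro e he hey
          rw [mem_insert] at he
          rcases he with rfl | he
          · simp
          · rcases hB e he with h | h | h
            · rw [hey] at h; exact absurd h hy2C
            · simp [h]
            · simp [h])
        rw [card_pair hr1x.symm] at h3
        omega
    · have hRx : ∀ e ∈ insert f R, e ∉ rowS x0 := by
        intro e he hr
        rw [mem_rowS] at hr
        rw [mem_insert] at he
        rcases he with rfl | he
        · exact hfx hr
        · rcases hR e he with h | h
          · have := hx0 _ h
            rw [← hr] at this
            exact disjoint_left.1 hd this he
          · rw [h] at hr; exact hr1x hr
      have hR0 := cnt_eq_zero hRx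
      have hrowB' : cnt (rowS x0) B ≤ C.card + 2 := by
        have h1 : (insert y2 (insert y C)).card = C.card + 2 := by
          rw [card_insert_of_notMem (by simp [hyy, hy2C]), card_insert_of_notMem hyC]
        rw [← h1]
        apply row_le'
        intro e he _
        rcases hB e he with h | h | h
        · simp [h]
        · simp [h]
        · simp [h]
      obtain ⟨e, he, h1, h2⟩ := exists_free (A := rowS x0) (B := B) (R := insert f R)
        (by rw [card_rowS]; omega)
      have e1 : cnt (rowS x0) (insert e B) = cnt (rowS x0) B + 1 := by
        rw [cnt_insert h1, if_pos he]
      have heC : e.2 ∉ C := by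
        intro heC
        rw [mem_rowS] at he
        apply h1
        have := hx0 _ heC
        rwa [← he] at this
      by_cases hh : n = 2 * m
      · exact W.win _ _ e h1 h2 ⟨x0, c1, by simp [hx0 c1 hc1],
          Or.inr ⟨by omega, hdeep.trans (cnt_mono _ (subset_insert _ _))⟩⟩
      · apply W.mk h1 h2
        have e3 : cnt (oS C) (insert f R) = cnt (oS C) R + 1 := by
          rw [cnt_insert hfR, if_pos (by simp [hfC])]
        apply race x0 C c1 hc1 (by omega) _ (2 * m - n) _ _ (Nat.lt_succ_self _)
          (disj_insert hd h2 hfB)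
        · intro c hc; simp [hx0 c hc]
        · intro c hc
          rw [cnt_insert h1, cnt_insert hfR, if_neg, if_neg]
          · exact bal c hc
          · rw [mem_colS]; rintro rfl; exact heC hc
          · rw [mem_colS]; rintro rfl; exact hfC hc
        · exact hdeep.trans (cnt_mono _ (subset_insert _ _))
        · omega
        · omega
        · omega
        · omega

structure Sig (x0 : Fin (2 * n)) (C : Finset (Fin (2 * m + 1))) (c1 y : Fin (2 * m + 1))
    (r1 : Fin (2 * n)) (B R : Finset (Cell m n)) : Prop where
  disj : Disjoint B R
  bal : ∀ c ∈ C, cnt (colS c) R = cnt (colS c) B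
  hx0 : ∀ c ∈ C, (x0, c) ∈ B
  hxy : (x0, y) ∈ B
  hr1 : (r1, y) ∈ R
  hB : ∀ e ∈ B, e.2 ∈ C ∨ e = (x0, y)
  hR : ∀ e ∈ R, e.2 ∈ C ∨ e = (r1, y)
  yC : y ∉ C
  hc1 : c1 ∈ C
  deep : m + 1 ≤ cnt (colS c1) B
  hCm : m ≤ C.card

lemma lead (x0 : Fin (2 * n)) (C : Finset (Fin (2 * m + 1))) (c1 : Fin (2 * m + 1))
    (hc1 : c1 ∈ C) (y : Fin (2 * m + 1)) (hyC : y ∉ C) (hC : C.card + 2 + 2 * m ≤ 2 * n)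
    (hCm : m ≤ C.card) (hm : 1 ≤ m) (hmn : m < n) (hn : n ≤ 2 * m)
    (H : ∀ r1 B R, Sig x0 C c1 y r1 B R → W B R) (N : ℕ) :
    ∀ (B R : Finset (Cell m n)), (Fr B R).card < N → Disjoint B R →
      (∀ c ∈ C, (x0, c) ∈ B) → (∀ c ∈ C, cnt (colS c) R = cnt (colS c) B) →
      m + 1 ≤ cnt (colS c1) B → (x0, y) ∈ B →
      (∀ e ∈ B, e.2 ∈ C ∨ e = (x0, y)) →
      (∀ e ∈ R, e.2 ∈ C) → V B R := by
  induction N with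
  | zero => intro B R h; omega
  | succ N ih =>
  intro B R hN hd hx0 bal hdeep hxy hB hR f hfB hfR
  have ho : cnt (oS C) R = 0 := cnt_eq_zero (by
    intro e he heC
    rw [mem_oS] at heC
    exact heC (hR e he))
  refine ⟨red_check hd hfB hfR bal (by omega), ?_⟩
  by_cases hfC : f.2 ∈ C
  · obtain ⟨e, he, h1, h2⟩ := col_answer hd hfB hfR (bal _ hfC)
    apply W.mk h1 h2
    have := Fr_right hfB hfR
    have := Fr_left h1 h2
    apply ih _ _ (by omega) (disj_insert hd h2 hfB)
    · intro c hc; simp [hx0 c hc]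
    · intro c hc; exact bal_answer h1 hfR he (bal c hc)
    · exact hdeep.trans (cnt_mono _ (subset_insert _ _))
    · simp [hxy]
    · intro g hg
      rw [mem_insert] at hg
      rcases hg with rfl | hg
      · left; rw [he]; exact hfC
      · exact hB g hg
    · intro g hg
      rw [mem_insert] at hg
      rcases hg with rfl | hg
      · exact hfC
      · exact hR g hg
  · have hdf : Disjoint B (insert f R) := by
      rw [disjoint_insert_right]; exact ⟨hfB, hd⟩
    have hbalf : ∀ c ∈ C, cnt (colS c) (insert f R) = cnt (colS c) B := by
      intro c hc
      rw [cnt_insert hfR, if_neg]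
      · exact bal c hc
      · rw [mem_colS]; rintro rfl; exact hfC hc
    by_cases hfy : f.2 = y
    · have hf : f = (f.1, y) := by rw [← hfy]
      apply H f.1
      refine ⟨hdf, hbalf, hx0, hxy, ?_, hB, ?_, hyC, hc1, hdeep, hCm⟩
      · rw [← hf]; simp
      · intro e he
        rw [mem_insert] at he
        rcases he with rfl | he
        · right; exact hf
        · left; exact hR e he
    · obtain ⟨s, hs, hsf⟩ : ∃ s : Fin (2 * n), s ≠ x0 ∧ (f.1 ≠ x0 → s = f.1) := by
        by_cases h : f.1 = x0
        · have : Nontrivial (Fin (2 * n)) := Fin.nontrivial_iff_two_le.2 (by omega)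
          obtain ⟨s, hs⟩ := exists_ne x0
          exact ⟨s, hs, fun h' => absurd h h'⟩
        · exact ⟨f.1, h, fun _ => rfl⟩
      have h1 : ((s, y) : Cell m n) ∉ B := by
        intro h
        rcases hB _ h with h | h
        · exact hyC h
        · exact hs (congrArg Prod.fst h)
      have h2 : ((s, y) : Cell m n) ∉ insert f R := by
        intro h
        rw [mem_insert] at h
        rcases h with h | h
        · exact hfy (by rw [← h])
        · exact hyC (hR _ h)
      apply W.mk h1 h2
      have htB : (f.1, y) ∈ insert (s, y) B := by
        by_cases h : f.1 = x0
        · rw [h]; simp [hxy]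
        · rw [hsf h]; simp
      apply PInv.v (x0 := x0) (y := y) (C := C) (t := f.1) (y0 := y) (r1 := f.1) _ {f.1} _ _
        (Nat.lt_succ_self _)
      have hRo : ∀ e ∈ insert f R, e.2 ∉ C → e = f := by
        intro e he ho
        rw [mem_insert] at he
        rcases he with he | he
        · exact he
        · exact absurd (hR e he) ho
      refine ⟨disj_insert hd h2 hfB, by simp [hxy], ?_, hyC, ?_, ?_, ?_, ?_, ?_, ?_, by simp,
        htB, htB, htB, by omega⟩
      · have h3 := le_row (insert y C) x0 (insert (s, y) B) (by
          intro c hc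
          rw [mem_insert] at hc
          rcases hc with rfl | hc
          · simp [hxy]
          · simp [hx0 c hc])
        rw [card_insert_of_notMem hyC] at h3
        omega
      · intro c hc
        rw [cnt_insert h1, if_neg]
        · exact hbalf c hc
        · rw [mem_colS]; rintro rfl; exact hyC hc
      · intro r hr
        rw [mem_singleton] at hr
        rw [cnt_eq_zero]
        · exact Nat.zero_le _
        · intro e he ho
          rw [mem_outS] at ho
          rw [hRo e he ho.2] at ho
          exact hr ho.1.symm
      · intro r hr
        left
        have : cnt (outS C r) (insert f R) ≤ 1 := cnt_le_one f (by
          intro e he ho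
          rw [mem_outS] at ho
          exact hRo e he ho.2)
        omega
      · intro e he heC
        left
        rw [hRo e he heC]; simp
      · have h3 := le_col {x0, s} y (insert (s, y) B) (by
          intro c hc
          rw [mem_insert, mem_singleton] at hc
          rcases hc with rfl | rfl
          · simp [hxy]
          · simp)
        rw [card_pair hs.symm] at h3
        rw [card_singleton]; exact h3
      · have h3 := col_le {x0, s} y (insert (s, y) B) (by
          intro e he hey
          rw [mem_insert] at he
          rcases he with rfl | he
          · simp
          · rcases hB e he with h | h
            · rw [hey] at h; exact absurd h hyC
            · simp [h])
        rw [card_pair hs.symm] at h3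
        omega

lemma Sig.w (x0 : Fin (2 * n)) (c1 : Fin (2 * m + 1)) (hm : 1 ≤ m) (hmn : m < n)
    (hn : n ≤ 2 * m) (N : ℕ) :
    ∀ (C : Finset (Fin (2 * m + 1))) (y : Fin (2 * m + 1)) (r1 : Fin (2 * n))
      (B R : Finset (Cell m n)), C.card + 2 + 2 * m + N = 2 * n → Sig x0 C c1 y r1 B R →
      W B R := by
  induction N with
  | zero =>
    intro C y r1 B R hN S
    obtain ⟨y2, hy2⟩ : ∃ y2, y2 ∉ insert y C := by
      by_contra h
      push Not at h
      have h1 := card_le_card (fun c (_ : c ∈ (univ : Finset (Fin (2 * m + 1)))) => h c)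
      rw [card_insert_of_notMem S.yC] at h1
      simp at h1
      omega
    rw [mem_insert, not_or] at hy2
    have h1 : ((x0, y2) : Cell m n) ∉ B := by
      intro h
      rcases S.hB _ h with h | h
      · exact hy2.2 h
      · exact hy2.1 (congrArg Prod.snd h)
    have h2 : ((x0, y2) : Cell m n) ∉ R := by
      intro h
      rcases S.hR _ h with h | h
      · exact hy2.2 h
      · exact hy2.1 (congrArg Prod.snd h)
    apply W.mk h1 h2
    apply final_lead x0 C c1 S.hc1 y y2 r1 S.yC hy2.2 hy2.1 (by omega) S.hCm hm hmn hn _ _ _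
      (Nat.lt_succ_self _)
    · rw [disjoint_insert_left]; exact ⟨h2, S.disj⟩
    · intro c hc; simp [S.hx0 c hc]
    · intro c hc
      rw [cnt_insert h1, if_neg]
      · exact S.bal c hc
      · rw [mem_colS]; rintro rfl; exact hy2.2 hc
    · exact S.deep.trans (cnt_mono _ (subset_insert _ _))
    · simp [S.hxy]
    · simp
    · exact S.hr1
    · intro e he
      rw [mem_insert] at he
      rcases he with rfl | he
      · simp
      · rcases S.hB e he with h | h
        · exact Or.inl h
        · exact Or.inr (Or.inl h)
    · exact S.hR
  | succ N ih =>
    intro C y r1 B R hN S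
    have hcard := card_insert_of_notMem S.yC
    obtain ⟨y2, hy2'⟩ : ∃ y2, y2 ∉ insert y C := by
      by_contra h
      push Not at h
      have h1 := card_le_card (fun c (_ : c ∈ (univ : Finset (Fin (2 * m + 1)))) => h c)
      rw [card_insert_of_notMem S.yC] at h1
      simp at h1
      omega
    have hy2 := hy2'
    rw [mem_insert, not_or] at hy2
    have h1 : ((x0, y2) : Cell m n) ∉ B := by
      intro h
      rcases S.hB _ h with h | h
      · exact hy2.2 h
      · exact hy2.1 (congrArg Prod.snd h)
    have h2 : ((x0, y2) : Cell m n) ∉ R := by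
      intro h
      rcases S.hR _ h with h | h
      · exact hy2.2 h
      · exact hy2.1 (congrArg Prod.snd h)
    apply W.mk h1 h2
    apply lead x0 (insert y C) c1 (by simp [S.hc1]) y2 hy2' (by omega)
      (by have := S.hCm; omega) hm hmn hn _ _ _ _ (Nat.lt_succ_self _)
    · rw [disjoint_insert_left]; exact ⟨h2, S.disj⟩
    · intro c hc
      rw [mem_insert] at hc
      rcases hc with rfl | hc
      · simp [S.hxy]
      · simp [S.hx0 c hc]
    · intro c hc
      rw [cnt_insert h1, if_neg]
      · rw [mem_insert] at hc
        rcases hc with rfl | hc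
        · have a1 : cnt (colS c) R ≤ 1 := cnt_le_one (r1, c) (by
            intro e he hec
            rw [mem_colS] at hec
            exact (S.hR e he).resolve_left (by rw [hec]; exact S.yC))
          have a2 : cnt (colS c) B ≤ 1 := cnt_le_one (x0, c) (by
            intro e he hec
            rw [mem_colS] at hec
            exact (S.hB e he).resolve_left (by rw [hec]; exact S.yC))
          have a3 : 1 ≤ cnt (colS c) R := cnt_pos S.hr1 (by simp)
          have a4 : 1 ≤ cnt (colS c) B := cnt_pos S.hxy (by simp)
          omega
        · exact S.bal c hc
      · rw [mem_colS]; rintro rfl; exact hy2' hc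
    · exact S.deep.trans (cnt_mono _ (subset_insert _ _))
    · simp
    · intro e he
      rw [mem_insert] at he
      rcases he with rfl | he
      · simp
      · rcases S.hB e he with h | h
        · left; simp [h]
        · left; simp [h]
    · intro e he
      rcases S.hR e he with h | h
      · simp [h]
      · simp [h]
    · intro r B' R' S'
      exact ih (insert y C) y2 r B' R' (by omega) S'

structure Row (x0 : Fin (2 * n)) (C : Finset (Fin (2 * m + 1))) (B R : Finset (Cell m n)) :
    Prop where
  hB : ∀ e : Cell m n, e ∈ B ↔ e.1 = x0 ∧ e.2 ∈ C
  one : ∀ c ∈ C, cnt (colS c) R = 1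
  hR : ∀ e ∈ R, e.1 ≠ x0 ∧ e.2 ∈ C
  cB : B.card = C.card
  cR : R.card = C.card

lemma Row.disj {x0 : Fin (2 * n)} {C : Finset (Fin (2 * m + 1))} {B R : Finset (Cell m n)}
    (h : Row x0 C B R) : Disjoint B R := by
  rw [disjoint_left]
  intro e he hr
  exact (h.hR e hr).1 ((h.hB e).1 he).1

lemma cnt_le_one_insert {A S : Finset (Cell m n)} {f : Cell m n} (h : ∀ e ∈ S, e ∉ A) :
    cnt A (insert f S) ≤ 1 := by
  apply cnt_le_one f
  intro e he heA
  rw [mem_insert] at he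
  rcases he with he | he
  · exact he
  · exact absurd heA (h e he)

lemma row_stage (x0 : Fin (2 * n)) (hm : 1 ≤ m) (hmn : m < n)
    (H : ∀ (C : Finset (Fin (2 * m + 1))) (B R : Finset (Cell m n)), C.card = m + 1 →
      Row x0 C B R → W B R) (N : ℕ) :
    ∀ (C : Finset (Fin (2 * m + 1))) (B R : Finset (Cell m n)), C.card + N = m + 1 →
      Row x0 C B R → W B R := by
  induction N with
  | zero => intro C B R h S; exact H C B R (by omega) S
  | succ N ih =>
  intro C B R hN S
  obtain ⟨y, hy⟩ : ∃ y, y ∉ C := by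
    by_contra h
    push Not at h
    have h1 := card_le_card (fun c (_ : c ∈ (univ : Finset (Fin (2 * m + 1)))) => h c)
    simp at h1
    omega
  have h1 : ((x0, y) : Cell m n) ∉ B := fun h => hy ((S.hB _).1 h).2
  have h2 : ((x0, y) : Cell m n) ∉ R := fun h => hy (S.hR _ h).2
  have hcB := card_insert_of_notMem h1
  have cB := S.cB
  have cR := S.cR
  apply W.mk h1 h2
  intro f hfB hfR
  have hcR := card_insert_of_notMem hfR
  refine ⟨fun h => by have := h.card_le; omega, ?_⟩
  have hBi : ∀ e : Cell m n, e ∈ insert (x0, y) B ↔ e.1 = x0 ∧ e.2 ∈ insert y C := by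
    intro e
    rw [mem_insert, mem_insert, S.hB, Prod.ext_iff]
    tauto
  have hd : Disjoint (insert (x0, y) B) (insert f R) := by
    rw [disjoint_insert_right, disjoint_insert_left]
    exact ⟨hfB, h2, S.disj⟩
  by_cases hfy : f.2 = y
  · apply ih (insert y C)
    · rw [card_insert_of_notMem hy]; omega
    · refine ⟨hBi, ?_, ?_, ?_, ?_⟩
      · intro c hc
        rw [cnt_insert hfR]
        rw [mem_insert] at hc
        rcases hc with rfl | hc
        · rw [if_pos (by simp [hfy]), cnt_eq_zero]
          intro e he hec
          rw [mem_colS] at hec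
          exact hy (hec ▸ (S.hR e he).2)
        · rw [if_neg, S.one c hc]
          rw [mem_colS, hfy]
          rintro rfl
          exact hy hc
      · intro e he
        rw [mem_insert] at he
        rcases he with rfl | he
        · refine ⟨fun h => hfB ?_, by simp [hfy]⟩
          rw [hBi]
          exact ⟨h, by simp [hfy]⟩
        · exact ⟨(S.hR e he).1, mem_insert_of_mem (S.hR e he).2⟩
      · rw [card_insert_of_notMem hy]; omega
      · rw [card_insert_of_notMem hy]; omega
  · by_cases hp : C.card = 0
    · -- first move
      have hB0 : B = ∅ := card_eq_zero.1 (by omega)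
      have hR0 : R = ∅ := card_eq_zero.1 (by omega)
      subst hB0 hR0
      obtain ⟨x1, hx1⟩ : ∃ x1, x1 ∉ ({x0, f.1} : Finset (Fin (2 * n))) := by
        by_contra h
        push Not at h
        have h1 := card_le_card (fun c (_ : c ∈ (univ : Finset (Fin (2 * n)))) => h c)
        have h2 := card_le_two (a := x0) (b := f.1)
        simp at h1
        omega
      rw [mem_insert, mem_singleton, not_or] at hx1
      have h3 : ((x1, y) : Cell m n) ∉ insert (x0, y) (∅ : Finset (Cell m n)) := by
        intro h
        simp at h
        exact hx1.1 h
      have h4 : ((x1, y) : Cell m n) ∉ insert f (∅ : Finset (Cell m n)) := by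
        intro h
        simp at h
        exact hx1.2 (by rw [← h])
      have hcB2 := card_insert_of_notMem h3
      apply W.mk h3 h4
      intro g hgB hgR
      have hcR2 := card_insert_of_notMem hgR
      refine ⟨fun h => by have := h.card_le; omega, ?_⟩
      have hgrc : ¬ (g ∈ rowS x1 ∧ g ∈ colS y) := by
        rintro ⟨h5, h6⟩
        rw [mem_rowS] at h5
        rw [mem_colS] at h6
        apply hgB
        have : g = (x1, y) := by ext <;> simp [h5, h6]
        rw [this]; simp
      have r1 : cnt (rowS x1) (insert (x1, y) (insert (x0, y) (∅ : Finset (Cell m n)))) = 1 := by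
        rw [cnt_insert h3, if_pos (by simp), cnt_eq_zero]
        intro e he
        simp at he
        rw [he, mem_rowS]
        exact fun h => hx1.1 h.symm
      have r2 : cnt (colS y) (insert (x1, y) (insert (x0, y) (∅ : Finset (Cell m n)))) = 2 := by
        rw [cnt_insert h3, if_pos (by simp), cnt_insert h1, if_pos (by simp), cnt_eq_zero]
        simp
      have r3 : cnt (rowS x1) (insert f (∅ : Finset (Cell m n))) = 0 := by
        apply cnt_eq_zero
        intro e he
        simp at he
        rw [he, mem_rowS]
        exact fun h => hx1.2 h.symm
      have r4 : cnt (colS y) (insert f (∅ : Finset (Cell m n))) = 0 := by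
        apply cnt_eq_zero
        intro e he
        simp at he
        rw [he, mem_colS]
        exact hfy
      apply noWaste x1 y (m + n - 2) _ _ m (n - 1) (by omega) (disj_insert hd _ _)
      · omega
      · simp
      · left
        rw [r1, r2]
        omega
      · rw [r1, r2, cnt_insert hgR, cnt_insert hgR, r3, r4]
        by_cases h5 : g ∈ rowS x1
        · have h6 : g ∉ colS y := fun h6 => hgrc ⟨h5, h6⟩
          rw [if_pos h5, if_neg h6]; omega
        · rw [if_neg h5]
          split_ifs <;> omega
      · omega
      · rw [mem_insert, not_or]
        exact ⟨fun h => hgB (by rw [← h]; simp), h4⟩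
      · exact fun h => hgB (mem_insert_of_mem h)
    · have r1 : C.card + 1 ≤ cnt (rowS x0) (insert (x0, y) B) := by
        have := le_row (insert y C) x0 (insert (x0, y) B) (fun c hc => (hBi _).2 ⟨rfl, hc⟩)
        rwa [card_insert_of_notMem hy] at this
      have r1' := cnt_le_card (rowS x0) (insert (x0, y) B)
      have r2 : cnt (colS y) (insert (x0, y) B) = 1 := by
        rw [cnt_insert h1, if_pos (by simp), cnt_eq_zero]
        intro e he hey
        rw [mem_colS] at hey
        exact hy (hey ▸ ((S.hB e).1 he).2)
      have r3 : cnt (rowS x0) (insert f R) ≤ 1 := cnt_le_one_insert (by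
        intro e he her
        rw [mem_rowS] at her
        exact (S.hR e he).1 her)
      have r4 : cnt (colS y) (insert f R) = 0 := by
        rw [cnt_insert hfR, if_neg (by simpa using hfy), cnt_eq_zero]
        intro e he hey
        rw [mem_colS] at hey
        exact hy (hey ▸ (S.hR e he).2)
      apply noWaste x0 y (m - C.card + n - 1) _ _ (m - C.card) n (by omega) hd
      · omega
      · simp
      · left; omega
      · right; omega
      · omega

structure Col (x0 : Fin (2 * n)) (C : Finset (Fin (2 * m + 1))) (c1 : Fin (2 * m + 1)) (k : ℕ)
    (B R : Finset (Cell m n)) : Prop where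
  disj : Disjoint B R
  hx0 : ∀ c ∈ C, (x0, c) ∈ B
  hB : ∀ e ∈ B, e.2 ∈ C ∧ (e.2 ≠ c1 → e.1 = x0)
  hR : ∀ e ∈ R, e.2 ∈ C
  one : ∀ c ∈ C, c ≠ c1 → cnt (colS c) R = 1
  cB1 : cnt (colS c1) B = k
  cR1 : cnt (colS c1) R = k
  cB : B.card = m + k
  cR : R.card = m + k

lemma col_stage (x0 : Fin (2 * n)) (C : Finset (Fin (2 * m + 1))) (c1 : Fin (2 * m + 1))
    (hc1 : c1 ∈ C) (hC : C.card = m + 1) (hm : 1 ≤ m) (hmn : m < n) (hn : n ≤ 2 * m)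
    (hbig : 3 * m + 2 ≤ 2 * n) (N : ℕ) :
    ∀ (k : ℕ) (B R : Finset (Cell m n)), k + N = m + 1 → Col x0 C c1 k B R → W B R := by
  induction N with
  | zero =>
    intro k B R hk S
    obtain ⟨y, hy, hyc⟩ : ∃ y ∈ C, y ≠ c1 := exists_mem_ne (by omega) c1
    obtain ⟨g, hg⟩ := card_eq_one.1 (S.one y hy hyc)
    have hg' : g ∈ R ∩ colS y := by rw [hg]; simp
    rw [mem_inter, mem_colS] at hg'
    have hgy : g = (g.1, y) := by rw [← hg'.2]
    have hcard := card_erase_add_one hy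
    apply Sig.w x0 c1 hm hmn hn (2 * n - 2 * m - 2 - m) (C.erase y) y g.1 B R (by omega)
    refine ⟨S.disj, ?_, ?_, S.hx0 y hy, ?_, ?_, ?_, by simp, ?_, ?_, by omega⟩
    · intro c hc
      rw [mem_erase] at hc
      by_cases hcc : c = c1
      · rw [hcc, S.cB1, S.cR1]
      · rw [S.one c hc.2 hcc]
        have a1 : 1 ≤ cnt (colS c) B := cnt_pos (S.hx0 c hc.2) (by simp)
        have a2 : cnt (colS c) B ≤ 1 := cnt_le_one (x0, c) (by
          intro e he hec
          rw [mem_colS] at hec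
          have := (S.hB e he).2 (by rw [hec]; exact hcc)
          ext <;> simp [hec, this])
        omega
    · intro c hc
      exact S.hx0 c (mem_of_mem_erase hc)
    · rw [← hgy]; exact hg'.1
    · intro e he
      have := S.hB e he
      by_cases hey : e.2 = y
      · right
        have h3 := this.2 (by rw [hey]; exact hyc)
        ext <;> simp [hey, h3]
      · left; exact mem_erase.2 ⟨hey, this.1⟩
    · intro e he
      by_cases hey : e.2 = y
      · right
        have h3 : e ∈ R ∩ colS y := by simp [he, hey]
        rw [hg, mem_singleton] at h3
        rw [h3]; exact hgy
      · left; exact mem_erase.2 ⟨hey, S.hR e he⟩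
    · exact mem_erase.2 ⟨hyc.symm, hc1⟩
    · rw [S.cB1]; omega
  | succ N ih =>
    intro k B R hk S
    have cB := S.cB
    have cR := S.cR
    have cB1 := S.cB1
    have cR1 := S.cR1
    obtain ⟨e, he, h1, h2⟩ := exists_free (A := colS c1) (B := B) (R := R)
      (by rw [card_colS]; omega)
    have he2 : e.2 = c1 := by simpa using he
    have hcB := card_insert_of_notMem h1
    have e1 : cnt (colS c1) (insert e B) = k + 1 := by rw [cnt_insert h1, if_pos he, cB1]
    apply W.mk h1 h2
    intro f hfB hfR
    have hcR := card_insert_of_notMem hfR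
    refine ⟨fun h => by have := h.card_le; omega, ?_⟩
    have hd : Disjoint (insert e B) (insert f R) := by
      rw [disjoint_insert_right, disjoint_insert_left]
      exact ⟨hfB, h2, S.disj⟩
    by_cases hf : f.2 = c1
    · apply ih (k + 1) _ _ (by omega)
      refine ⟨hd, ?_, ?_, ?_, ?_, e1, ?_, by omega, by omega⟩
      · intro c hc; exact mem_insert_of_mem (S.hx0 c hc)
      · intro g hg
        rw [mem_insert] at hg
        rcases hg with rfl | hg
        · exact ⟨by rw [he2]; exact hc1, fun h => absurd he2 h⟩
        · exact S.hB g hg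
      · intro g hg
        rw [mem_insert] at hg
        rcases hg with rfl | hg
        · rw [hf]; exact hc1
        · exact S.hR g hg
      · intro c hc hcc
        rw [cnt_insert hfR, if_neg, S.one c hc hcc]
        rw [mem_colS, hf]
        exact hcc.symm
      · rw [cnt_insert hfR, if_pos (by simpa using hf), cR1]
    · have e2 : cnt (colS c1) (insert f R) = k := by
        rw [cnt_insert hfR, if_neg (by simpa using hf), cR1]; rfl
      have r1 : m + 1 ≤ cnt (rowS x0) (insert e B) := by
        rw [← hC]
        apply le_row
        intro c hc; exact mem_insert_of_mem (S.hx0 c hc)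
      have r2 := cnt_le (A := rowS x0) hd
      rw [card_rowS] at r2
      apply noWaste x0 c1 (n - k - 1) _ _ 0 (n - k) (by omega) hd
      · omega
      · exact mem_insert_of_mem (S.hx0 c1 hc1)
      · left; omega
      · right; omega
      · omega

lemma main (hm : 1 ≤ m) (hmn : m < n) (hn : n ≤ 2 * m) :
    W (∅ : Finset (Cell m n)) ∅ := by
  have x0 : Fin (2 * n) := ⟨0, by omega⟩
  apply row_stage x0 hm hmn _ (m + 1) ∅ ∅ ∅ (by simp)
  · refine ⟨by simp, by simp, by simp, rfl, rfl⟩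
  intro C B R hC S
  obtain ⟨c1, hc1⟩ : C.Nonempty := card_pos.1 (by omega)
  have hx0 : ∀ c ∈ C, (x0, c) ∈ B := fun c hc => (S.hB _).2 ⟨rfl, hc⟩
  have cB := S.cB
  have cR := S.cR
  have a1 : 1 ≤ cnt (colS c1) B := cnt_pos (hx0 c1 hc1) (by simp)
  have a2 : cnt (colS c1) B ≤ 1 := cnt_le_one (x0, c1) (by
    intro e he hec
    rw [mem_colS] at hec
    have := ((S.hB e).1 he).1
    ext <;> simp [hec, this])
  have a3 := S.one c1 hc1
  have a4 : cnt (rowS x0) R = 0 := cnt_eq_zero (by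
    intro e he her
    rw [mem_rowS] at her
    exact (S.hR e he).1 her)
  have a5 := le_row C x0 B hx0
  have a6 := cnt_le_card (rowS x0) B
  by_cases hbig : 2 * n ≤ 3 * m + 1
  · apply noWaste x0 c1 (n - 1) _ _ (n - m) m (by omega) S.disj
    · omega
    · exact hx0 c1 hc1
    · right; omega
    · left; omega
    · omega
  · apply col_stage x0 C c1 hc1 hC hm hmn hn (by omega) m 1 B R (by omega)
    refine ⟨S.disj, hx0, ?_, fun e he => (S.hR e he).2, fun c hc _ => S.one c hc, by omega, a3,
      by omega, by omega⟩
    intro e he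
    exact ⟨((S.hB e).1 he).2, fun _ => ((S.hB e).1 he).1⟩

abbrev Vx (m n : ℕ) := Fin (2 * n) ⊕ Fin (2 * m + 1)

/-- the edge of the bipartite graph given by a cell -/
def edge (c : Cell m n) : Sym2 (Vx m n) := s(Sum.inl c.1, Sum.inr c.2)

lemma edge_eq_row {c : Cell m n} {x : Fin (2 * n)} {v : Vx m n}
    (h : edge c = s(Sum.inl x, v)) : c.1 = x ∧ v = Sum.inr c.2 := by
  unfold edge at h
  rw [Sym2.eq_iff] at h
  rcases h with ⟨h1, h2⟩ | ⟨h1, h2⟩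
  · exact ⟨Sum.inl_injective h1, h2.symm⟩
  · exact absurd h2 (by simp)

lemma edge_eq_col {c : Cell m n} {y : Fin (2 * m + 1)} {v : Vx m n}
    (h : edge c = s(Sum.inr y, v)) : c.2 = y ∧ v = Sum.inl c.1 := by
  unfold edge at h
  rw [Sym2.eq_iff] at h
  rcases h with ⟨h1, h2⟩ | ⟨h1, h2⟩
  · exact absurd h1 (by simp)
  · exact ⟨Sum.inr_injective h2, h1.symm⟩

lemma edge_injective : Function.Injective (edge : Cell m n → Sym2 (Vx m n)) := by
  intro a b h
  have := edge_eq_row (c := a) (x := b.1) (v := Sum.inr b.2) h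
  ext
  · rw [this.1]
  · rw [Sum.inr_injective this.2]

lemma mem_edgeSet (e : Sym2 (Vx m n)) :
    e ∈ (completeBipartiteGraph (Fin (2 * n)) (Fin (2 * m + 1))).edgeSet ↔ ∃ c, e = edge c := by
  induction e using Sym2.ind with
  | _ u v =>
    rw [SimpleGraph.mem_edgeSet]
    constructor
    · intro h
      rcases u with x | y <;> rcases v with x' | y' <;> simp at h
      · exact ⟨(x, y'), rfl⟩
      · exact ⟨(x', y), Sym2.eq_swap⟩
    · rintro ⟨c, hc⟩
      unfold edge at hc
      rw [Sym2.eq_iff] at hc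
      rcases hc with ⟨rfl, rfl⟩ | ⟨rfl, rfl⟩ <;> simp

lemma ncard_edgeSet :
    (completeBipartiteGraph (Fin (2 * n)) (Fin (2 * m + 1))).edgeSet.ncard =
      2 * n * (2 * m + 1) := by
  have : (completeBipartiteGraph (Fin (2 * n)) (Fin (2 * m + 1))).edgeSet =
      (edge : Cell m n → Sym2 (Vx m n)) '' Set.univ := by
    ext e
    rw [mem_edgeSet]
    simp [eq_comm]
  rw [this, Set.ncard_image_of_injective _ edge_injective, Set.ncard_univ]
  simp

lemma copy_of {α : Type*} {s : Set (Sym2 α)} (u v : α) (g : Fin m → α) (g' : Fin n → α)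
    (hg : Function.Injective g) (hg' : Function.Injective g') (huv : u ≠ v)
    (h1 : ∀ i, g i ≠ u ∧ g i ≠ v) (h2 : ∀ i, g' i ≠ u ∧ g' i ≠ v) (h3 : ∀ i j, g i ≠ g' j)
    (e0 : s(u, v) ∈ s) (e1 : ∀ i, s(u, g i) ∈ s) (e2 : ∀ i, s(v, g' i) ∈ s) :
    HasCopy (doubleStar m n) s := by
  let F : Fin (m + 1) ⊕ Fin (n + 1) → α := Sum.elim (Fin.cons u g) (Fin.cons v g')
  have hF : Function.Injective F := by
    apply Function.Injective.sumElim
    · rw [Fin.cons_injective_iff]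
      refine ⟨?_, hg⟩
      rintro ⟨i, hi⟩
      exact (h1 i).1 hi
    · rw [Fin.cons_injective_iff]
      refine ⟨?_, hg'⟩
      rintro ⟨i, hi⟩
      exact (h2 i).2 hi
    · intro a b
      induction a using Fin.cases with
      | zero =>
        induction b using Fin.cases with
        | zero => simpa using huv
        | succ j => simpa using (h2 j).1.symm
      | succ i =>
        induction b using Fin.cases with
        | zero => simpa using (h1 i).2
        | succ j => simpa using h3 i j
  have key : ∀ a b, a ≠ b → ((a = Sum.inl 0 ∧ ∃ i, b = Sum.inl i) ∨
      (a = Sum.inr 0 ∧ ∃ j, b = Sum.inr j) ∨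
      (a = Sum.inl 0 ∧ b = Sum.inr 0)) → s(F a, F b) ∈ s := by
    rintro a b hab (⟨rfl, i, rfl⟩ | ⟨rfl, i, rfl⟩ | ⟨rfl, rfl⟩)
    · induction i using Fin.cases with
      | zero => exact absurd rfl hab
      | succ i => simpa [F] using e1 i
    · induction i using Fin.cases with
      | zero => exact absurd rfl hab
      | succ i => simpa [F] using e2 i
    · simpa [F] using e0
  refine ⟨⟨F, hF⟩, ?_⟩
  intro a b hab
  unfold doubleStar at hab
  rw [SimpleGraph.fromRel_adj] at hab
  rcases hab with ⟨hne, h | h⟩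
  · exact key a b hne h
  · have := key b a hne.symm h
    rw [Sym2.eq_swap]
    exact this

lemma exists_inj {β : Type*} [DecidableEq β] (S : Finset β) (k : ℕ) (b : β) (hb : b ∈ S)
    (h : k + 1 ≤ S.card) :
    ∃ g : Fin k → β, Function.Injective g ∧ ∀ i, g i ∈ S ∧ g i ≠ b := by
  have h1 := card_erase_add_one hb
  obtain ⟨T, hT, hTc⟩ := exists_subset_card_eq (s := S.erase b) (n := k) (by omega)
  refine ⟨fun i => (T.equivFin.symm (Fin.cast hTc.symm i) : β), ?_, ?_⟩
  · intro i j hij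
    simpa using hij
  · intro i
    have := hT (T.equivFin.symm (Fin.cast hTc.symm i)).2
    rw [mem_erase] at this
    exact ⟨this.2, this.1⟩

lemma Good.copy {S : Finset (Cell m n)} {s : Set (Sym2 (Vx m n))} (h : Good S)
    (hs : ∀ c ∈ S, edge c ∈ s) : HasCopy (doubleStar m n) s := by
  obtain ⟨x, y, hxy, h⟩ := h
  have hrow : ∀ k, k + 1 ≤ cnt (rowS x) S → ∃ g : Fin k → Fin (2 * m + 1),
      Function.Injective g ∧ ∀ i, (x, g i) ∈ S ∧ g i ≠ y := by
    intro k hk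
    obtain ⟨g, hg, hg2⟩ := exists_inj (S ∩ rowS x) k (x, y) (by simp [hxy]) hk
    have h1 : ∀ i, g i = (x, (g i).2) := by
      intro i
      have := (hg2 i).1
      rw [mem_inter, mem_rowS] at this
      rw [← this.2]
    refine ⟨fun i => (g i).2, ?_, ?_⟩
    · intro i j hij
      apply hg
      rw [h1 i, h1 j]
      exact congrArg _ hij
    · intro i
      refine ⟨?_, ?_⟩
      · rw [← h1 i]; exact (mem_inter.1 (hg2 i).1).1
      · intro h3
        apply (hg2 i).2
        rw [h1 i]
        simp only at h3
        rw [h3]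
  have hcol : ∀ k, k + 1 ≤ cnt (colS y) S → ∃ g : Fin k → Fin (2 * n),
      Function.Injective g ∧ ∀ i, (g i, y) ∈ S ∧ g i ≠ x := by
    intro k hk
    obtain ⟨g, hg, hg2⟩ := exists_inj (S ∩ colS y) k (x, y) (by simp [hxy]) hk
    have h1 : ∀ i, g i = ((g i).1, y) := by
      intro i
      have := (hg2 i).1
      rw [mem_inter, mem_colS] at this
      rw [← this.2]
    refine ⟨fun i => (g i).1, ?_, ?_⟩
    · intro i j hij
      apply hg
      rw [h1 i, h1 j]
      exact congrArg (fun z => (z, y)) hij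
    · intro i
      refine ⟨?_, ?_⟩
      · rw [← h1 i]; exact (mem_inter.1 (hg2 i).1).1
      · intro h3
        apply (hg2 i).2
        rw [h1 i]
        simp only at h3
        rw [h3]
  rcases h with ⟨hr, hc⟩ | ⟨hr, hc⟩
  · obtain ⟨g, hg, hgS⟩ := hrow m hr
    obtain ⟨g', hg', hgS'⟩ := hcol n hc
    apply copy_of (Sum.inl x) (Sum.inr y) (fun i => Sum.inr (g i)) (fun i => Sum.inl (g' i))
      (Sum.inr_injective.comp hg) (Sum.inl_injective.comp hg') (by simp)
    · intro i; simpa using (hgS i).2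
    · intro i; simpa using (hgS' i).2
    · intro i j; simp
    · exact hs _ hxy
    · intro i; exact hs _ (hgS i).1
    · intro i; rw [Sym2.eq_swap]; exact hs _ (hgS' i).1
  · obtain ⟨g, hg, hgS⟩ := hrow n hr
    obtain ⟨g', hg', hgS'⟩ := hcol m hc
    apply copy_of (Sum.inr y) (Sum.inl x) (fun i => Sum.inl (g' i)) (fun i => Sum.inr (g i))
      (Sum.inl_injective.comp hg') (Sum.inr_injective.comp hg) (by simp)
    · intro i; simpa using (hgS' i).2
    · intro i; simpa using (hgS i).2
    · intro i j; simp
    · rw [Sym2.eq_swap]; exact hs _ hxy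
    · intro i; rw [Sym2.eq_swap]; exact hs _ (hgS' i).1
    · intro i; exact hs _ (hgS i).1

lemma cnt_row_of {S : Finset (Cell m n)} {k : ℕ} {x : Fin (2 * n)} (h : Fin k → Vx m n)
    (hi : Function.Injective h) (hS : ∀ i, ∃ c ∈ S, edge c = s(Sum.inl x, h i)) :
    k ≤ cnt (rowS x) S := by
  choose c hc1 hc2 using hS
  have := card_le_card_of_injOn (s := (univ : Finset (Fin k))) (t := S ∩ rowS x) c (by
    intro i _
    have := (edge_eq_row (hc2 i)).1
    simp [hc1 i, this]) (by
    intro i _ j _ hij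
    apply hi
    rw [(edge_eq_row (hc2 i)).2, (edge_eq_row (hc2 j)).2, hij])
  simpa [cnt] using this

lemma cnt_col_of {S : Finset (Cell m n)} {k : ℕ} {y : Fin (2 * m + 1)} (h : Fin k → Vx m n)
    (hi : Function.Injective h) (hS : ∀ i, ∃ c ∈ S, edge c = s(Sum.inr y, h i)) :
    k ≤ cnt (colS y) S := by
  choose c hc1 hc2 using hS
  have := card_le_card_of_injOn (s := (univ : Finset (Fin k))) (t := S ∩ colS y) c (by
    intro i _
    have := (edge_eq_col (hc2 i)).1
    simp [hc1 i, this]) (by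
    intro i _ j _ hij
    apply hi
    rw [(edge_eq_col (hc2 i)).2, (edge_eq_col (hc2 j)).2, hij])
  simpa [cnt] using this

lemma good_of_copy {S : Finset (Cell m n)} {s : Set (Sym2 (Vx m n))}
    (hs : ∀ e ∈ s, ∃ c ∈ S, edge c = e) (h : HasCopy (doubleStar m n) s) : Good S := by
  obtain ⟨f, hf⟩ := h
  have hne : (Sum.inl 0 : Fin (m + 1) ⊕ Fin (n + 1)) ≠ Sum.inr 0 := by simp
  have e0 : s(f (Sum.inl 0), f (Sum.inr 0)) ∈ s := by
    apply hf
    unfold doubleStar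
    rw [SimpleGraph.fromRel_adj]
    exact ⟨hne, Or.inl (Or.inr (Or.inr ⟨rfl, rfl⟩))⟩
  let h1 : Fin (m + 1) → Vx m n := Fin.cons (f (Sum.inr 0)) (fun i => f (Sum.inl i.succ))
  let h2 : Fin (n + 1) → Vx m n := Fin.cons (f (Sum.inl 0)) (fun i => f (Sum.inr i.succ))
  have i1 : Function.Injective h1 := by
    rw [Fin.cons_injective_iff]
    refine ⟨?_, ?_⟩
    · rintro ⟨i, hi⟩
      simpa using f.injective hi
    · intro i j hij
      simpa using f.injective hij
  have i2 : Function.Injective h2 := by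
    rw [Fin.cons_injective_iff]
    refine ⟨?_, ?_⟩
    · rintro ⟨i, hi⟩
      simpa using f.injective hi
    · intro i j hij
      simpa using f.injective hij
  have s1 : ∀ i, s(f (Sum.inl 0), h1 i) ∈ s := by
    intro i
    induction i using Fin.cases with
    | zero => exact e0
    | succ i =>
      apply hf
      unfold doubleStar
      rw [SimpleGraph.fromRel_adj]
      exact ⟨by simpa using (Fin.succ_ne_zero i).symm, Or.inl (Or.inl ⟨rfl, _, rfl⟩)⟩
  have s2 : ∀ i, s(f (Sum.inr 0), h2 i) ∈ s := by
    intro i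
    induction i using Fin.cases with
    | zero => rw [Sym2.eq_swap]; exact e0
    | succ i =>
      apply hf
      unfold doubleStar
      rw [SimpleGraph.fromRel_adj]
      exact ⟨by simpa using (Fin.succ_ne_zero i).symm, Or.inl (Or.inr (Or.inl ⟨rfl, _, rfl⟩))⟩
  obtain ⟨⟨x, y⟩, hc, hce⟩ := hs _ e0
  refine ⟨x, y, hc, ?_⟩
  have hce' := hce
  unfold edge at hce'
  rw [Sym2.eq_iff] at hce'
  rcases hce' with ⟨h3, h4⟩ | ⟨h3, h4⟩
  · left
    refine ⟨cnt_row_of h1 i1 ?_, cnt_col_of h2 i2 ?_⟩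
    · intro i; simp only at h3; rw [h3]; exact hs _ (s1 i)
    · intro i; simp only at h4; rw [h4]; exact hs _ (s2 i)
  · right
    refine ⟨cnt_row_of h2 i2 ?_, cnt_col_of h1 i1 ?_⟩
    · intro i; simp only at h3; rw [h3]; exact hs _ (s2 i)
    · intro i; simp only at h4; rw [h4]; exact hs _ (s1 i)

open Classical in
/-- cells played at indices of parity `p` in the history `l` -/
noncomputable def side (p : ℕ) (l : List (Sym2 (Vx m n))) : Finset (Cell m n) :=
  univ.filter (fun c => ∃ i, i % 2 = p ∧ l[i]? = some (edge c))

lemma mem_side (p : ℕ) (l : List (Sym2 (Vx m n))) (c : Cell m n) :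
    c ∈ side p l ↔ ∃ i, i % 2 = p ∧ l[i]? = some (edge c) := by
  unfold side; simp

lemma mem_list (l : List (Sym2 (Vx m n))) (c : Cell m n) :
    edge c ∈ l ↔ c ∈ side 0 l ∨ c ∈ side 1 l := by
  rw [mem_side, mem_side, List.mem_iff_getElem?]
  constructor
  · rintro ⟨i, hi⟩
    rcases Nat.mod_two_eq_zero_or_one i with h | h
    · exact Or.inl ⟨i, h, hi⟩
    · exact Or.inr ⟨i, h, hi⟩
  · rintro (⟨i, -, hi⟩ | ⟨i, -, hi⟩) <;> exact ⟨i, hi⟩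

lemma side_append (p : ℕ) (l : List (Sym2 (Vx m n))) (c : Cell m n) (h : l.length % 2 = p) :
    side p (l ++ [edge c]) = insert c (side p l) := by
  ext d
  rw [mem_insert, mem_side, mem_side]
  constructor
  · rintro ⟨i, hi, hd⟩
    rw [List.getElem?_append] at hd
    split_ifs at hd with hl
    · exact Or.inr ⟨i, hi, hd⟩
    · left
      rw [List.getElem?_singleton] at hd
      split_ifs at hd
      exact edge_injective (Option.some_injective _ hd).symm
  · rintro (rfl | ⟨i, hi, hd⟩)
    · exact ⟨l.length, h, by simp⟩
    · refine ⟨i, hi, ?_⟩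
      rw [List.getElem?_append_left]
      · exact hd
      · by_contra hc
        rw [List.getElem?_eq_none (by omega)] at hd
        exact absurd hd (by simp)

lemma side_append_ne (p : ℕ) (l : List (Sym2 (Vx m n))) (e : Sym2 (Vx m n))
    (h : l.length % 2 ≠ p) : side p (l ++ [e]) = side p l := by
  ext d
  rw [mem_side, mem_side]
  constructor
  · rintro ⟨i, hi, hd⟩
    rw [List.getElem?_append] at hd
    split_ifs at hd with hl
    · exact ⟨i, hi, hd⟩
    · rw [List.getElem?_singleton] at hd
      split_ifs at hd with h0
      have : i = l.length := by omega
      rw [this] at hi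
      exact absurd hi h
  · rintro ⟨i, hi, hd⟩
    refine ⟨i, hi, ?_⟩
    rw [List.getElem?_append_left]
    · exact hd
    · by_contra hc
      rw [List.getElem?_eq_none (by omega)] at hd
      exact absurd hd (by simp)

lemma W.elim {B R : Finset (Cell m n)} (h : W B R) :
    ∃ e, e ∉ B ∧ e ∉ R ∧ (Good (insert e B) ∨ V (insert e B) R) := by
  rcases h with ⟨_, _, e, hB, hR, h⟩ | ⟨_, _, e, hB, hR, h1, h2⟩
  · exact ⟨e, hB, hR, Or.inl h⟩
  · exact ⟨e, hB, hR, Or.inr (fun f hf hr => ⟨h1 f hf hr, h2 f hf hr⟩)⟩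

open Classical in
/-- the strategy of Alice -/
noncomputable def strat : Strategy (Vx m n) := fun l =>
  if h : W (side 0 l) (side 1 l) then edge h.elim.choose
  else if h' : ∃ e ∈ (completeBipartiteGraph (Fin (2 * n)) (Fin (2 * m + 1))).edgeSet, e ∉ l
    then h'.choose else s(Sum.inr 0, Sum.inr 0)

lemma strat_eq {l : List (Sym2 (Vx m n))} (h : W (side 0 l) (side 1 l)) :
    strat l = edge h.elim.choose := by
  unfold strat
  rw [dif_pos h]

lemma strat_valid : Strategy.Valid (completeBipartiteGraph (Fin (2 * n)) (Fin (2 * m + 1)))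
    (strat : Strategy (Vx m n)) := by
  intro l hl
  unfold strat
  by_cases h : W (side 0 l) (side 1 l)
  · rw [dif_pos h]
    have := h.elim.choose_spec
    refine ⟨(mem_edgeSet _).2 ⟨_, rfl⟩, ?_⟩
    rw [mem_list]
    tauto
  · rw [dif_neg h, dif_pos hl]
    exact hl.choose_spec

lemma hist_length {α : Type*} (σ τ : Strategy α) (k : ℕ) : (hist σ τ k).length = k := by
  induction k with
  | zero => rfl
  | succ k ih => simp [hist, ih]

lemma hist_get {α : Type*} (σ τ : Strategy α) (k i : ℕ) (h : i < k) :
    (hist σ τ k)[i]? = some (move σ τ i) := by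
  induction k with
  | zero => omega
  | succ k ih =>
    rw [hist, List.getElem?_append, hist_length]
    split_ifs with h1 h2
    · exact ih h1
    · have : i = k := by omega
      subst this
      simp [move, h2]
    · have : i = k := by omega
      subst this
      simp [move, h2]

lemma play (τ : Strategy (Vx m n))
    (hτ : Strategy.Valid (completeBipartiteGraph (Fin (2 * n)) (Fin (2 * m + 1))) τ) (N : ℕ) :
    ∀ (k : ℕ) (B R : Finset (Cell m n)), (Fr B R).card < N →
      B = side 0 (hist strat τ (2 * k)) → R = side 1 (hist strat τ (2 * k)) →
      (∀ e ∈ hist strat τ (2 * k), ∃ c, e = edge c) → Disjoint B R → B.card = k → R.card = k →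
      ¬ Good R → W B R →
      ∃ k : ℕ, 2 * k + 1 ≤
          (completeBipartiteGraph (Fin (2 * n)) (Fin (2 * m + 1))).edgeSet.ncard ∧
        HasCopy (doubleStar m n) {e | ∃ i ≤ k, e = move strat τ (2 * i)} ∧
        ¬ HasCopy (doubleStar m n) {e | ∃ i < k, e = move strat τ (2 * i + 1)} := by
  induction N with
  | zero => intro k B R h; omega
  | succ N ih =>
  intro k B R hN hB hR hE hd hBk hRk hG hW
  have hW' : W (side 0 (hist strat τ (2 * k))) (side 1 (hist strat τ (2 * k))) := by
    rw [← hB, ← hR]; exact hW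
  obtain ⟨e, hmv, h1, h2, h3⟩ : ∃ e, strat (hist strat τ (2 * k)) = edge e ∧ e ∉ B ∧ e ∉ R ∧
      (Good (insert e B) ∨ V (insert e B) R) := by
    rw [hB, hR]
    refine ⟨hW'.elim.choose, strat_eq hW', hW'.elim.choose_spec⟩
  have hh1 : hist strat τ (2 * k + 1) = hist strat τ (2 * k) ++ [edge e] := by
    rw [hist, if_pos (by omega), hmv]
  have hB1 : side 0 (hist strat τ (2 * k + 1)) = insert e B := by
    rw [hh1, side_append 0 _ _ (by rw [hist_length]; omega), hB]
  have hR1 : side 1 (hist strat τ (2 * k + 1)) = R := by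
    rw [hh1, side_append_ne 1 _ _ (by rw [hist_length]; omega), hR]
  have hd1 : Disjoint (insert e B) R := by
    rw [disjoint_insert_left]; exact ⟨h2, hd⟩
  have hcB := card_insert_of_notMem h1
  have htot : (insert e B ∪ R).card = 2 * k + 1 := by
    rw [card_union_of_disjoint hd1]; omega
  have hcell : Fintype.card (Cell m n) = 2 * n * (2 * m + 1) := by simp
  have hle := card_le_univ (insert e B ∪ R)
  rw [htot, hcell] at hle
  rcases h3 with h3 | h3
  · refine ⟨k, by rw [ncard_edgeSet]; exact hle, h3.copy ?_, ?_⟩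
    · intro c hc
      rw [← hB1, mem_side] at hc
      obtain ⟨i, hi, hic⟩ := hc
      have hlt : i < 2 * k + 1 := by
        by_contra hcon
        rw [List.getElem?_eq_none (by rw [hist_length]; omega)] at hic
        exact absurd hic (by simp)
      rw [hist_get _ _ _ _ hlt] at hic
      refine ⟨i / 2, by omega, ?_⟩
      rw [show 2 * (i / 2) = i by omega]
      exact (Option.some_injective _ hic).symm
    · intro hcp
      apply hG
      apply good_of_copy _ hcp
      rintro e' ⟨i, hi, rfl⟩
      have hg := hist_get strat τ (2 * k) (2 * i + 1) (by omega)
      obtain ⟨c, hc⟩ := hE _ (List.mem_iff_getElem?.2 ⟨_, hg⟩)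
      refine ⟨c, ?_, hc.symm⟩
      rw [hR, mem_side]
      exact ⟨2 * i + 1, by omega, by rw [hg, hc]⟩
  · have hex : ∃ c, c ∉ insert e B ∪ R := by
      by_contra hcon
      push Not at hcon
      have : insert e B ∪ R = univ := eq_univ_iff_forall.2 hcon
      rw [this, card_univ, hcell, mul_assoc] at htot
      omega
    obtain ⟨c, hc⟩ := hex
    have hval := hτ (hist strat τ (2 * k + 1)) ⟨edge c, (mem_edgeSet _).2 ⟨c, rfl⟩, by
      rw [mem_list, hB1, hR1]
      rw [mem_union] at hc
      exact hc⟩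
    obtain ⟨f, hf⟩ := (mem_edgeSet _).1 hval.1
    have hfn := hval.2
    rw [hf, mem_list, hB1, hR1, not_or] at hfn
    have hh2 : hist strat τ (2 * (k + 1)) = hist strat τ (2 * k + 1) ++ [edge f] := by
      rw [show 2 * (k + 1) = (2 * k + 1) + 1 by ring, hist, if_neg (by omega), hf]
    have hcR := card_insert_of_notMem hfn.2
    have hV := h3 f hfn.1 hfn.2
    have := Fr_left h1 h2
    have := Fr_right hfn.1 hfn.2
    apply ih (k + 1) (insert e B) (insert f R) (by omega)
    · rw [hh2, side_append_ne 0 _ _ (by rw [hist_length]; omega), hB1]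
    · rw [hh2, side_append 1 _ _ (by rw [hist_length]; omega), hR1]
    · intro e' he'
      rw [hh2, hh1] at he'
      simp only [List.mem_append, List.mem_singleton] at he'
      rcases he' with (he' | he') | he'
      · exact hE _ he'
      · exact ⟨e, he'⟩
      · exact ⟨f, he'⟩
    · rw [disjoint_insert_right]; exact ⟨hfn.1, hd1⟩
    · omega
    · omega
    · exact hV.1
    · exact hV.2

end DS

/-- Let `m, n` be integers with `1 ≤ m < n ≤ 2m`. Alice has a winning strategy in the
achievement game `(S_{m,n}, K_{2n,2m+1}, +)`. -/
theorem stmt8 (m n : ℕ) (hm : 1 ≤ m) (hmn : m < n) (hn : n ≤ 2 * m) :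
    AliceWins (doubleStar m n)
      (completeBipartiteGraph (Fin (2 * n)) (Fin (2 * m + 1))) := by
  refine ⟨DS.strat, DS.strat_valid, ?_⟩
  intro τ hτ
  apply DS.play τ hτ _ 0 ∅ ∅ (Nat.lt_succ_self _)
  · ext c; simp [DS.mem_side, hist]
  · ext c; simp [DS.mem_side, hist]
  · intro e he; simp [hist] at he
  · simp
  · rfl
  · rfl
  · intro h
    have := h.card_le
    simp at this
  · exact DS.main hm hmn hn
end

section
/- The bipartite achievement number of the star with four leaves satisfies ba(K_{1,4}) = 5; that is, Alice has a winning strategy in (K_{1,4}, K_{5,5}, +) but no winning strategy in (K_{1,4}, K_{4,4}, +). -/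
open AchievementGame

namespace StarFour

/-- Evaluate `n` to a literal before passing it on (a device for kernel evaluation). -/
def force {α : Type} (n : Nat) (k : Nat → α) : α :=
  match n with
  | 0 => k 0
  | m + 1 => k (Nat.succ m)

theorem force_eq {α : Type} (n : Nat) (k : Nat → α) : force n k = k n := by
  cases n <;> rfl

/-- Bit `k` of the mask `X`. -/
def bit (X k : Nat) : Nat := Nat.land (Nat.shiftRight X k) 1

/-- The mask `X` with bit `e` switched on. -/
def put (X e : Nat) : Nat := Nat.lor X (Nat.shiftLeft 1 e)

/-- Number of edges of `X` in row `i` (edge `(i, j)` has number `5 * i + j`). -/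
def rdeg (X i : Nat) : Nat :=
  force (Nat.shiftRight X (Nat.mul 5 i)) fun Y =>
    Nat.add (Nat.add (Nat.add (Nat.add (bit Y 0) (bit Y 1)) (bit Y 2)) (bit Y 3)) (bit Y 4)

/-- Number of edges of `X` in column `j`. -/
def cdeg (X j : Nat) : Nat :=
  force (Nat.shiftRight X j) fun Y =>
    Nat.add (Nat.add (Nat.add (Nat.add (bit Y 0) (bit Y 5)) (bit Y 10)) (bit Y 15)) (bit Y 20)

/-- Fast (unverified, only used as a heuristic) degree of vertex `v`:
rows are `0..4`, columns `5..9`. -/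
def fdeg (X v : Nat) : Nat :=
  bif Nat.ble v 4 then
    Nat.mod (Nat.land (Nat.mul (Nat.land (Nat.shiftRight X (Nat.mul 5 v)) 31) 1082401) 17043521) 63
  else Nat.mod (Nat.land (Nat.shiftRight X (Nat.sub v 5)) 1082401) 31

/-- Heuristic value of a vertex with `b` blue and `r` red edges, for the choice of the vertex. -/
def valV (b r : Nat) : Nat :=
  bif Nat.ble r 1 then Nat.sub (Nat.add (Nat.mul 2 b) 2) r else 0

/-- Heuristic value of a vertex, for the choice of the other end. -/
def valW (b r : Nat) : Nat :=
  bif Nat.beq r 0 then (bif Nat.beq b 1 then 3 else 1)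
  else bif Nat.beq r 1 then (bif Nat.beq b 1 then 1 else 2) else 1

def pickV (A B : Nat) : Nat → Nat → Nat → Nat
  | 0, _, bv => bv
  | v + 1, bs, bv =>
    force (valV (fdeg A v) (fdeg B v)) fun s =>
      bif Nat.ble bs s then pickV A B v s v else pickV A B v bs bv

def pickE (A B v : Nat) : Nat → Nat → Nat → Nat
  | 0, _, be => be
  | k + 1, bs, be =>
    force (bif Nat.ble v 4 then Nat.add (Nat.mul 5 v) k
      else Nat.add (Nat.mul 5 k) (Nat.sub v 5)) fun e =>
    force (bif Nat.ble v 4 then Nat.add 5 k else k) fun o =>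
    bif Nat.beq (bit (Nat.lor A B) e) 1 then pickE A B v k bs be
    else force (valW (fdeg A o) (fdeg B o)) fun s =>
      bif Nat.ble bs s then pickE A B v k s e else pickE A B v k bs be

/-- Alice's heuristic move. -/
def strat (A B : Nat) : Nat :=
  force (pickV A B 10 0 0) fun v => pickE A B v 5 0 25

/-- Edge `e` is on the board and uncolored. -/
def free (A B e : Nat) : Bool :=
  Nat.ble e 24 && (Nat.beq (bit A e) 0 && Nat.beq (bit B e) 0)

/-- Some end of edge `e` has degree at least four in `X`. -/
def fourAt (X e : Nat) : Bool :=
  Nat.ble 4 (rdeg X (Nat.div e 5)) || Nat.ble 4 (cdeg X (Nat.mod e 5))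

/-- All degrees in `X` are at most two. -/
def small (X : Nat) : Bool :=
  [0, 1, 2, 3, 4].all fun i => Nat.ble (rdeg X i) 2 && Nat.ble (cdeg X i) 2

/-- `p` holds for all numbers less than `n`. -/
def allB (p : Nat → Bool) : Nat → Bool
  | 0 => true
  | n + 1 => p n && allB p n

/-- Alice, to move, wins with the heuristic strategy within `n` moves. -/
def chk : Nat → Nat → Nat → Bool
  | 0, _, _ => false
  | n + 1, A, B =>
    force (strat A B) fun e =>
    force (put A e) fun A' =>
    free A B e && (fourAt A' e || (small B &&
      force (strat A' B) fun t =>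
      bif free A' B t && fourAt (put A' t) t then
        force (put B t) fun B' => chk n A' B'
      else allB (fun f => !free A' B f || force (put B f) fun B' => chk n A' B') 25))


theorem chk_row : chk 7 1 2 = true := by decide +kernel
theorem chk_col : chk 7 1 32 = true := by decide +kernel
theorem chk_diag : chk 7 1 64 = true := by decide +kernel

/-! ### General facts about plays -/

section General

variable {α β : Type} {F : SimpleGraph β} {G : SimpleGraph α}

theorem hist_length (σ τ : Strategy α) (n : ℕ) : (hist σ τ n).length = n := by
  induction n with
  | zero => rfl
  | succ n ih => simp [hist, ih]

theorem hist_getElem? (σ τ : Strategy α) (n i : ℕ) (e : Sym2 α) :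
    (hist σ τ n)[i]? = some e ↔ i < n ∧ e = move σ τ i := by
  induction n with
  | zero => simp [hist]
  | succ n ih =>
    have hl := hist_length σ τ n
    rcases lt_trichotomy i n with h | h | h
    · rw [hist, List.getElem?_append_left (by omega), ih]
      constructor
      · rintro ⟨_, h2⟩; exact ⟨by omega, h2⟩
      · rintro ⟨_, h2⟩; exact ⟨h, h2⟩
    · subst h
      rw [hist, List.getElem?_append_right (by omega), hl]
      simp only [Nat.sub_self, List.getElem?_cons_zero, Option.some.injEq]
      constructor
      · intro h2; exact ⟨by omega, h2.symm⟩
      · rintro ⟨_, h2⟩; exact h2.symm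
    · rw [List.getElem?_eq_none (by rw [hist_length]; omega)]
      constructor
      · intro h2; cases h2
      · rintro ⟨h2, _⟩; omega

theorem mem_hist (σ τ : Strategy α) (n : ℕ) (e : Sym2 α) :
    e ∈ hist σ τ n ↔ ∃ i < n, e = move σ τ i := by
  rw [List.mem_iff_getElem?]
  constructor
  · rintro ⟨i, hi⟩; exact ⟨i, (hist_getElem? σ τ n i e).1 hi⟩
  · rintro ⟨i, hi⟩; exact ⟨i, (hist_getElem? σ τ n i e).2 hi⟩

theorem exists_free {l : List (Sym2 α)} (h : l.length < G.edgeSet.ncard) :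
    ∃ e ∈ G.edgeSet, e ∉ l := by
  by_contra hc
  push Not at hc
  have h1 : G.edgeSet ⊆ {e | e ∈ l} := hc
  classical
  have h2 : ({e | e ∈ l} : Set (Sym2 α)) = (l.toFinset : Set (Sym2 α)) := by ext; simp
  rw [h2] at h1
  have h3 := Set.ncard_le_ncard h1 (Finset.finite_toSet _)
  rw [Set.ncard_coe_finset] at h3
  have := List.toFinset_card_le l
  omega

theorem move_valid {σ τ : Strategy α} (hσ : σ.Valid G) (hτ : τ.Valid G) {i : ℕ}
    (hi : i < G.edgeSet.ncard) :
    move σ τ i ∈ G.edgeSet ∧ ∀ j < i, move σ τ i ≠ move σ τ j := by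
  have hf := exists_free (G := G) (l := hist σ τ i) (by rwa [hist_length])
  have key : move σ τ i ∈ G.edgeSet ∧ move σ τ i ∉ hist σ τ i := by
    unfold move
    split_ifs
    · exact hσ _ hf
    · exact hτ _ hf
  refine ⟨key.1, fun j hj he => key.2 ?_⟩
  rw [mem_hist]
  exact ⟨j, hj, he⟩

/-- Alice, to move with blue edges `A` and red edges `B`, can win within `n` moves. -/
def Win (F : SimpleGraph β) (G : SimpleGraph α) : ℕ → Set (Sym2 α) → Set (Sym2 α) → Prop
  | 0, _, _ => False
  | n + 1, A, B => ∃ e ∈ G.edgeSet, e ∉ A ∧ e ∉ B ∧ (HasCopy F (insert e A) ∨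
      ∀ f ∈ G.edgeSet, f ∉ insert e A → f ∉ B →
        ¬ HasCopy F (insert f B) ∧ Win F G n (insert e A) (insert f B))

/-- `e` is a winning move for Alice with `n + 1` moves to go. -/
def Good (F : SimpleGraph β) (G : SimpleGraph α) (n : ℕ) (A B : Set (Sym2 α)) (e : Sym2 α) :
    Prop :=
  e ∈ G.edgeSet ∧ e ∉ A ∧ e ∉ B ∧ (HasCopy F (insert e A) ∨
      ∀ f ∈ G.edgeSet, f ∉ insert e A → f ∉ B →
        ¬ HasCopy F (insert f B) ∧ Win F G n (insert e A) (insert f B))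

/-- Edges at even positions of a list. -/
def blueL (l : List (Sym2 α)) : Set (Sym2 α) := {e | ∃ i, l[2 * i]? = some e}

/-- Edges at odd positions of a list. -/
def redL (l : List (Sym2 α)) : Set (Sym2 α) := {e | ∃ i, l[2 * i + 1]? = some e}

open Classical in
/-- Alice's strategy following winning moves. -/
noncomputable def aliceStrat (F : SimpleGraph β) (G : SimpleGraph α) (N : ℕ) (d : Sym2 α) :
    Strategy α := fun l =>
  if h : ∃ e, Good F G (N - 1 - l.length / 2) (blueL l) (redL l) e then h.choose
  else if h : ∃ e ∈ G.edgeSet, e ∉ l then h.choose else d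

theorem not_mem_of {l : List (Sym2 α)} {e : Sym2 α} (h1 : e ∉ blueL l) (h2 : e ∉ redL l) :
    e ∉ l := by
  intro h
  obtain ⟨i, hi⟩ := List.mem_iff_getElem?.1 h
  rcases Nat.even_or_odd' i with ⟨c, rfl | rfl⟩
  · exact h1 ⟨c, hi⟩
  · exact h2 ⟨c, hi⟩

theorem aliceStrat_valid (N : ℕ) (d : Sym2 α) : (aliceStrat F G N d).Valid G := by
  intro l hl
  unfold aliceStrat
  split_ifs with h
  · have := h.choose_spec
    exact ⟨this.1, not_mem_of this.2.1 this.2.2.1⟩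
  · exact hl.choose_spec

theorem aliceWins_of_win {N : ℕ} (hN : 2 * N ≤ G.edgeSet.ncard)
    (hF : ¬ HasCopy F (∅ : Set (Sym2 α)))
    (hW : Win F G N ∅ ∅) (d : Sym2 α) : AliceWins F G := by
  refine ⟨aliceStrat F G N d, aliceStrat_valid N d, fun τ hτ => ?_⟩
  set σ := aliceStrat F G N d with hσd
  have hσ : σ.Valid G := aliceStrat_valid N d
  have main : ∀ n m : ℕ, m + n = N →
      ¬ HasCopy F {e | ∃ i < m, e = move σ τ (2 * i + 1)} →
      Win F G n {e | ∃ i < m, e = move σ τ (2 * i)} {e | ∃ i < m, e = move σ τ (2 * i + 1)} →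
      ∃ k : ℕ, 2 * k + 1 ≤ G.edgeSet.ncard ∧
      HasCopy F {e | ∃ i ≤ k, e = move σ τ (2 * i)} ∧
      ¬ HasCopy F {e | ∃ i < k, e = move σ τ (2 * i + 1)} := by
    intro n
    induction n with
    | zero => intro m _ _ h; exact h.elim
    | succ n ih =>
      intro m hmn hB hw
      have hblue : blueL (hist σ τ (2 * m)) = {e | ∃ i < m, e = move σ τ (2 * i)} := by
        ext e
        simp only [blueL, Set.mem_ofPred_eq, hist_getElem?]
        exact exists_congr fun i => and_congr_left fun _ => by omega
      have hred : redL (hist σ τ (2 * m)) = {e | ∃ i < m, e = move σ τ (2 * i + 1)} := by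
        ext e
        simp only [redL, Set.mem_ofPred_eq, hist_getElem?]
        exact exists_congr fun i => and_congr_left fun _ => by omega
      have hgood : Good F G n {e | ∃ i < m, e = move σ τ (2 * i)}
          {e | ∃ i < m, e = move σ τ (2 * i + 1)} (move σ τ (2 * m)) := by
        have hex : ∃ e, Good F G (N - 1 - (hist σ τ (2 * m)).length / 2)
            (blueL (hist σ τ (2 * m))) (redL (hist σ τ (2 * m))) e := by
          rw [hblue, hred, hist_length]
          have : N - 1 - 2 * m / 2 = n := by omega
          rw [this]
          exact hw
        have hmv : move σ τ (2 * m) = hex.choose := by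
          unfold move
          rw [if_pos (by omega)]
          exact dif_pos hex
        have hs := hex.choose_spec
        rw [← hmv, hblue, hred, hist_length] at hs
        have : N - 1 - 2 * m / 2 = n := by omega
        rwa [this] at hs
      have hins : ∀ g : ℕ → Sym2 α, insert (g m) {e | ∃ i < m, e = g i} =
          {e | ∃ i < m + 1, e = g i} := by
        intro g
        ext e
        simp only [Set.mem_insert_iff, Set.mem_ofPred_eq]
        constructor
        · rintro (h | ⟨i, hi, h⟩)
          · exact ⟨m, by omega, h⟩
          · exact ⟨i, by omega, h⟩
        · rintro ⟨i, hi, h⟩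
          rcases Nat.lt_succ_iff_lt_or_eq.1 hi with h1 | h1
          · exact Or.inr ⟨i, h1, h⟩
          · subst h1; exact Or.inl h
      have hinsA := hins fun i => move σ τ (2 * i)
      have hinsB := hins fun i => move σ τ (2 * i + 1)
      obtain ⟨_, _, _, hg⟩ := hgood
      rcases hg with hg | hg
      · refine ⟨m, by omega, ?_, hB⟩
        rw [hinsA] at hg
        simpa only [Nat.lt_succ_iff] using hg
      · have hv := move_valid hσ hτ (i := 2 * m + 1) (by omega)
        have := hg (move σ τ (2 * m + 1)) hv.1 ?_ ?_
        · rw [hinsA, hinsB] at this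
          exact ih (m + 1) (by omega) this.1 this.2
        · rw [hinsA]
          rintro ⟨i, hi, h⟩
          exact hv.2 _ (by omega) h
        · rintro ⟨i, hi, h⟩
          exact hv.2 _ (by omega) h
  have h0 : ({e | ∃ i < 0, e = move σ τ (2 * i)} : Set (Sym2 α)) = ∅ := by ext; simp
  have h0' : ({e | ∃ i < 0, e = move σ τ (2 * i + 1)} : Set (Sym2 α)) = ∅ := by ext; simp
  refine main N 0 (by omega) ?_ ?_
  · rwa [h0']
  · rwa [h0, h0']

/-- Transport of winning positions along an automorphism. -/
theorem hasCopy_map (φ : α ≃ α) {S : Set (Sym2 α)} (h : HasCopy F S) :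
    HasCopy F (Sym2.map φ '' S) := by
  obtain ⟨f, hf⟩ := h
  exact ⟨f.trans φ.toEmbedding, fun a b hab => ⟨_, hf a b hab, by simp⟩⟩

theorem map_symm_map (φ : α ≃ α) (e : Sym2 α) : Sym2.map φ (Sym2.map φ.symm e) = e := by
  rw [Sym2.map_map]; simp

theorem map_map_symm (φ : α ≃ α) (e : Sym2 α) : Sym2.map φ.symm (Sym2.map φ e) = e := by
  rw [Sym2.map_map]; simp

theorem image_symm_image (φ : α ≃ α) (S : Set (Sym2 α)) :
    Sym2.map φ.symm '' (Sym2.map φ '' S) = S := by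
  rw [Set.image_image]; simp [map_map_symm]

theorem win_map (φ : α ≃ α) (hφ : ∀ e, Sym2.map φ e ∈ G.edgeSet ↔ e ∈ G.edgeSet) (n : ℕ) :
    ∀ A B : Set (Sym2 α), Win F G n A B → Win F G n (Sym2.map φ '' A) (Sym2.map φ '' B) := by
  have hinj : Function.Injective (Sym2.map φ) := Sym2.map.injective φ.injective
  induction n with
  | zero => intro A B h; exact h
  | succ n ih =>
    rintro A B ⟨e, he, heA, heB, h⟩
    refine ⟨Sym2.map φ e, (hφ e).2 he, by rwa [hinj.mem_set_image], by rwa [hinj.mem_set_image],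
      ?_⟩
    rcases h with h | h
    · left
      rw [← Set.image_insert_eq]
      exact hasCopy_map φ h
    · right
      intro f hf hfA hfB
      obtain ⟨g, rfl⟩ : ∃ g, Sym2.map φ g = f := ⟨_, map_symm_map φ f⟩
      rw [← Set.image_insert_eq] at hfA ⊢
      rw [← Set.image_insert_eq]
      rw [hinj.mem_set_image] at hfA hfB
      obtain ⟨h1, h2⟩ := h g ((hφ g).1 hf) hfA hfB
      refine ⟨fun hc => h1 ?_, ih _ _ h2⟩
      have := hasCopy_map φ.symm hc
      rwa [image_symm_image] at this

end General

/-! ### Complete bipartite graphs -/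

section Bipartite

variable {n : ℕ}

/-- The edge `(i, j)` of the complete bipartite graph. -/
def ed (i j : Fin n) : Sym2 (Fin n ⊕ Fin n) := s(Sum.inl i, Sum.inr j)

theorem ed_inj {i j i' j' : Fin n} : ed i j = ed i' j' ↔ i = i' ∧ j = j' := by
  simp [ed]

theorem mem_edgeSet {e : Sym2 (Fin n ⊕ Fin n)} :
    e ∈ (completeBipartiteGraph (Fin n) (Fin n)).edgeSet ↔ ∃ i j, e = ed i j := by
  induction e using Sym2.ind with
  | _ x y =>
    rcases x with x | x <;> rcases y with y | y <;>
      simp [completeBipartiteGraph, ed]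

theorem ncard_edgeSet : (completeBipartiteGraph (Fin n) (Fin n)).edgeSet.ncard = n * n := by
  have h : (completeBipartiteGraph (Fin n) (Fin n)).edgeSet =
      (fun p : Fin n × Fin n => ed p.1 p.2) '' Set.univ := by
    ext e
    rw [mem_edgeSet]
    constructor
    · rintro ⟨i, j, rfl⟩; exact ⟨(i, j), trivial, rfl⟩
    · rintro ⟨p, _, rfl⟩; exact ⟨_, _, rfl⟩
  rw [h, Set.ncard_image_of_injective, Set.ncard_univ]
  · simp
  · intro p q hpq
    have := ed_inj.1 hpq
    exact Prod.ext this.1 this.2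

theorem star_adj {m : ℕ} (k : Fin m) : (AchievementGame.star m).Adj 0 k.succ := by
  simp [AchievementGame.star, (Fin.succ_ne_zero k).symm]

/-- A copy of a star in a set of edges of the complete bipartite graph. -/
theorem copy_star {m : ℕ} {S : Set (Sym2 (Fin n ⊕ Fin n))}
    (hS : S ⊆ (completeBipartiteGraph (Fin n) (Fin n)).edgeSet) (h : HasCopy (AchievementGame.star m) S) :
    ∃ g : Fin m ↪ Fin n, (∃ i, ∀ k, ed i (g k) ∈ S) ∨ (∃ j, ∀ k, ed (g k) j ∈ S) := by
  obtain ⟨f, hf⟩ := h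
  have hk : ∀ k : Fin m, s(f 0, f k.succ) ∈ S := fun k => hf 0 k.succ (star_adj k)
  rcases h0 : f 0 with i | j
  · have h1 : ∀ k : Fin m, ∃ j, f k.succ = Sum.inr j := by
      intro k
      obtain ⟨a, b, hab⟩ := mem_edgeSet.1 (hS (hk k))
      rw [h0] at hab
      rcases hs : f k.succ with x | x
      · rw [hs] at hab; simp [ed] at hab
      · exact ⟨x, rfl⟩
    choose g hg using h1
    refine ⟨⟨g, fun a b hab => ?_⟩, Or.inl ⟨i, fun k => ?_⟩⟩
    · have : f a.succ = f b.succ := by rw [hg, hg, hab]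
      exact Fin.succ_injective _ (f.injective this)
    · have := hk k
      rw [h0, hg] at this
      exact this
  · have h1 : ∀ k : Fin m, ∃ i, f k.succ = Sum.inl i := by
      intro k
      obtain ⟨a, b, hab⟩ := mem_edgeSet.1 (hS (hk k))
      rw [h0] at hab
      rcases hs : f k.succ with x | x
      · exact ⟨x, rfl⟩
      · rw [hs] at hab; simp [ed] at hab
    choose g hg using h1
    refine ⟨⟨g, fun a b hab => ?_⟩, Or.inr ⟨j, fun k => ?_⟩⟩
    · have : f a.succ = f b.succ := by rw [hg, hg, hab]
      exact Fin.succ_injective _ (f.injective this)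
    · have := hk k
      rw [h0, hg, Sym2.eq_swap] at this
      exact this

theorem star_copy_row {m : ℕ} {S : Set (Sym2 (Fin n ⊕ Fin n))} (g : Fin m ↪ Fin n) (i : Fin n)
    (h : ∀ k, ed i (g k) ∈ S) : HasCopy (AchievementGame.star m) S := by
  refine ⟨⟨Fin.cons (Sum.inl i) fun k => Sum.inr (g k), ?_⟩, ?_⟩
  · rw [Fin.cons_injective_iff]
    refine ⟨by simp, fun a b hab => g.injective (Sum.inr_injective hab)⟩
  · intro a b hab
    simp only [AchievementGame.star, SimpleGraph.fromRel_adj] at hab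
    obtain ⟨hne, rfl | rfl⟩ := hab
    · obtain ⟨k, rfl⟩ := Fin.exists_succ_eq.2 hne.symm
      exact h k
    · obtain ⟨k, rfl⟩ := Fin.exists_succ_eq.2 hne
      rw [Sym2.eq_swap]
      exact h k

theorem star_copy_col {m : ℕ} {S : Set (Sym2 (Fin n ⊕ Fin n))} (g : Fin m ↪ Fin n) (j : Fin n)
    (h : ∀ k, ed (g k) j ∈ S) : HasCopy (AchievementGame.star m) S := by
  refine ⟨⟨Fin.cons (Sum.inr j) fun k => Sum.inl (g k), ?_⟩, ?_⟩
  · rw [Fin.cons_injective_iff]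
    refine ⟨by simp, fun a b hab => g.injective (Sum.inl_injective hab)⟩
  · intro a b hab
    simp only [AchievementGame.star, SimpleGraph.fromRel_adj] at hab
    obtain ⟨hne, rfl | rfl⟩ := hab
    · obtain ⟨k, rfl⟩ := Fin.exists_succ_eq.2 hne.symm
      rw [Sym2.eq_swap]
      exact h k
    · obtain ⟨k, rfl⟩ := Fin.exists_succ_eq.2 hne
      exact h k

end Bipartite

/-! ### Soundness of the checker -/

/-- The set of edges coded by the mask `X`. -/
def dec (X : ℕ) : Set (Sym2 (Fin 5 ⊕ Fin 5)) :=
  {e | ∃ i j : Fin 5, e = ed i j ∧ X.testBit (5 * i + j) = true}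

theorem ed_mem_dec {X : ℕ} {i j : Fin 5} :
    ed i j ∈ dec X ↔ X.testBit (5 * i + j) = true := by
  constructor
  · rintro ⟨i', j', h, h2⟩
    obtain ⟨rfl, rfl⟩ := ed_inj.1 h
    exact h2
  · intro h; exact ⟨i, j, rfl, h⟩

instance (X : ℕ) (i j : Fin 5) : Decidable (ed i j ∈ dec X) :=
  decidable_of_iff _ ed_mem_dec.symm

theorem dec_subset (X : ℕ) : dec X ⊆ (completeBipartiteGraph (Fin 5) (Fin 5)).edgeSet := by
  rintro e ⟨i, j, rfl, _⟩
  exact mem_edgeSet.2 ⟨i, j, rfl⟩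

theorem bit_eq (X k : ℕ) : bit X k = (X.testBit k).toNat := by
  have h : bit X k = (X >>> k) &&& 1 := rfl
  rw [h, Nat.and_one_is_mod, Nat.toNat_testBit, Nat.shiftRight_eq_div_pow]

theorem bit_shift (X s k : ℕ) : bit (Nat.shiftRight X s) k = (X.testBit (s + k)).toNat := by
  have h : Nat.shiftRight X s = X >>> s := rfl
  rw [bit_eq, h, Nat.testBit_shiftRight]

theorem put_eq (X e : ℕ) : put X e = X ||| 1 <<< e := rfl

theorem dec_put (X : ℕ) (i j : Fin 5) :
    dec (put X (5 * i + j)) = insert (ed i j) (dec X) := by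
  ext e
  constructor
  · rintro ⟨a, b, rfl, h⟩
    rw [put_eq, Nat.testBit_or, Nat.one_shiftLeft, Nat.testBit_two_pow] at h
    by_cases hc : 5 * (i : ℕ) + j = 5 * (a : ℕ) + b
    · left
      rw [ed_inj, Fin.ext_iff, Fin.ext_iff]
      omega
    · right
      rw [ed_mem_dec]
      simpa [hc] using h
  · rintro (rfl | ⟨a, b, rfl, h⟩)
    · rw [ed_mem_dec, put_eq, Nat.testBit_or, Nat.one_shiftLeft, Nat.testBit_two_pow]
      simp
    · rw [ed_mem_dec, put_eq, Nat.testBit_or, h]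
      simp

theorem rdeg_eq (X : ℕ) (i : Fin 5) :
    rdeg X i = (Finset.univ.filter fun j : Fin 5 => ed i j ∈ dec X).card := by
  simp only [ed_mem_dec]
  rw [Finset.card_filter, Fin.sum_univ_five]
  simp only [rdeg, force_eq, bit_shift, Bool.toNat, Bool.cond_eq_ite]
  rfl

theorem cdeg_eq (X : ℕ) (j : Fin 5) :
    cdeg X j = (Finset.univ.filter fun i : Fin 5 => ed i j ∈ dec X).card := by
  simp only [ed_mem_dec]
  rw [Finset.card_filter, Fin.sum_univ_five]
  simp only [cdeg, force_eq, bit_shift, Bool.toNat, Bool.cond_eq_ite]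
  simp only [Nat.add_comm (j : ℕ)]
  rfl

theorem exists_emb {m : ℕ} (s : Finset (Fin 5)) (h : m ≤ s.card) :
    ∃ g : Fin m ↪ Fin 5, ∀ k, g k ∈ s :=
  ⟨(Fin.castLEEmb h).trans (s.orderEmbOfFin rfl).toEmbedding,
    fun _ => Finset.orderEmbOfFin_mem s rfl _⟩

theorem fourAt_sound {X : ℕ} {i j : Fin 5} (h : fourAt X (5 * i + j) = true) :
    HasCopy (AchievementGame.star 4) (dec X) := by
  have h1 : Nat.div (5 * i + j) 5 = i := by
    change (5 * (i : ℕ) + j) / 5 = i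
    omega
  have h2 : Nat.mod (5 * i + j) 5 = j := by
    change (5 * (i : ℕ) + j) % 5 = j
    omega
  rw [fourAt, h1, h2, Bool.or_eq_true, Nat.ble_eq, Nat.ble_eq, rdeg_eq, cdeg_eq] at h
  rcases h with h | h
  · obtain ⟨g, hg⟩ := exists_emb _ h
    exact star_copy_row g i fun k => (Finset.mem_filter.1 (hg k)).2
  · obtain ⟨g, hg⟩ := exists_emb _ h
    exact star_copy_col g j fun k => (Finset.mem_filter.1 (hg k)).2

theorem small_sound {X : ℕ} (h : small X = true) (i j : Fin 5) :
    ¬ HasCopy (AchievementGame.star 4) (insert (ed i j) (dec X)) := by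
  have hd : ∀ v : Fin 5, rdeg X v ≤ 2 ∧ cdeg X v ≤ 2 := by
    simp only [small, List.all_cons, List.all_nil, Bool.and_eq_true, Nat.ble_eq] at h
    intro v
    fin_cases v <;> simp_all
  intro hc
  obtain ⟨g, hg⟩ := copy_star (by
    rintro e (rfl | he)
    · exact mem_edgeSet.2 ⟨_, _, rfl⟩
    · exact dec_subset X he) hc
  have hcard : (Finset.univ.map g).card = 4 := by simp
  rcases hg with ⟨a, ha⟩ | ⟨a, ha⟩
  · have hsub : Finset.univ.map g ⊆
        insert j (Finset.univ.filter fun j : Fin 5 => ed a j ∈ dec X) := by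
      intro x hx
      obtain ⟨k, _, rfl⟩ := Finset.mem_map.1 hx
      rcases ha k with h1 | h1
      · exact Finset.mem_insert.2 (Or.inl (ed_inj.1 h1).2)
      · exact Finset.mem_insert_of_mem (Finset.mem_filter.2 ⟨Finset.mem_univ _, h1⟩)
    have h1 := Finset.card_le_card hsub
    have h2 := Finset.card_insert_le j (Finset.univ.filter fun j : Fin 5 => ed a j ∈ dec X)
    rw [← rdeg_eq] at h2
    have := (hd a).1
    omega
  · have hsub : Finset.univ.map g ⊆
        insert i (Finset.univ.filter fun i : Fin 5 => ed i a ∈ dec X) := by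
      intro x hx
      obtain ⟨k, _, rfl⟩ := Finset.mem_map.1 hx
      rcases ha k with h1 | h1
      · exact Finset.mem_insert.2 (Or.inl (ed_inj.1 h1).1)
      · exact Finset.mem_insert_of_mem (Finset.mem_filter.2 ⟨Finset.mem_univ _, h1⟩)
    have h1 := Finset.card_le_card hsub
    have h2 := Finset.card_insert_le i (Finset.univ.filter fun i : Fin 5 => ed i a ∈ dec X)
    rw [← cdeg_eq] at h2
    have := (hd a).2
    omega

theorem free_iff {A B : ℕ} {i j : Fin 5} :
    free A B (5 * i + j) = true ↔ ed i j ∉ dec A ∧ ed i j ∉ dec B := by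
  rw [ed_mem_dec, ed_mem_dec, free, Bool.and_eq_true, Bool.and_eq_true, Nat.ble_eq, Nat.beq_eq,
    Nat.beq_eq, bit_eq, bit_eq]
  have : 5 * (i : ℕ) + j ≤ 24 := by omega
  simp [this]

theorem free_code {A B e : ℕ} (h : free A B e = true) :
    ∃ i j : Fin 5, e = 5 * (i : ℕ) + j := by
  rw [free, Bool.and_eq_true, Nat.ble_eq] at h
  exact ⟨⟨e / 5, by omega⟩, ⟨e % 5, by omega⟩, by simp only; omega⟩

theorem allB_sound {p : ℕ → Bool} {n : ℕ} (h : allB p n = true) : ∀ k < n, p k = true := by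
  induction n with
  | zero => intro k hk; omega
  | succ n ih =>
    rw [allB, Bool.and_eq_true] at h
    intro k hk
    rcases Nat.lt_succ_iff_lt_or_eq.1 hk with h1 | rfl
    · exact ih h.2 k h1
    · exact h.1

theorem chk_sound (n : ℕ) : ∀ A B : ℕ, chk n A B = true →
    Win (AchievementGame.star 4) (completeBipartiteGraph (Fin 5) (Fin 5)) n (dec A) (dec B) := by
  induction n with
  | zero => intro A B h; simp [chk] at h
  | succ n ih =>
    intro A B h
    simp only [chk, force_eq] at h
    rw [Bool.and_eq_true] at h
    obtain ⟨hfree, h⟩ := h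
    obtain ⟨i, j, he⟩ := free_code hfree
    rw [he] at h hfree
    obtain ⟨hA, hB⟩ := free_iff.1 hfree
    refine ⟨ed i j, mem_edgeSet.2 ⟨i, j, rfl⟩, hA, hB, ?_⟩
    rw [← dec_put]
    set A' := put A (5 * i + j) with hA'
    rw [Bool.or_eq_true] at h
    rcases h with h | h
    · left
      exact fourAt_sound h
    · right
      rw [Bool.and_eq_true] at h
      obtain ⟨hsm, h⟩ := h
      intro f hf hfA hfB
      obtain ⟨a, b, rfl⟩ := mem_edgeSet.1 hf
      refine ⟨small_sound hsm a b, ?_⟩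
      generalize strat A' B = t at h
      rw [← dec_put]
      cases hc : (free A' B t && fourAt (put A' t) t) with
      | true =>
        rw [hc, cond_true] at h
        rw [Bool.and_eq_true] at hc
        obtain ⟨c, d, rfl⟩ := free_code hc.1
        by_cases hft : ed c d = ed a b
        · obtain ⟨rfl, rfl⟩ := ed_inj.1 hft
          exact ih _ _ h
        · cases n with
          | zero => simp [chk] at h
          | succ n =>
            obtain ⟨h1, h2⟩ := free_iff.1 hc.1
            refine ⟨ed c d, mem_edgeSet.2 ⟨c, d, rfl⟩, h1, ?_, Or.inl ?_⟩
            · rw [dec_put]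
              rintro (h3 | h3)
              · exact hft h3
              · exact h2 h3
            · rw [← dec_put]
              exact fourAt_sound hc.2
      | false =>
        rw [hc, cond_false] at h
        have := allB_sound h (5 * a + b) (by omega)
        rw [free_iff.2 ⟨hfA, hfB⟩] at this
        exact ih _ _ (by simpa using this)

theorem dec_zero : dec 0 = ∅ := by
  ext e
  simp [dec]

theorem dec_one : dec 1 = {ed 0 0} := by
  have := dec_put 0 0 0
  rw [dec_zero, show put 0 (5 * ((0 : Fin 5) : ℕ) + ((0 : Fin 5) : ℕ)) = 1 from rfl] at this
  simpa using this

theorem win_start : Win (AchievementGame.star 4) (completeBipartiteGraph (Fin 5) (Fin 5)) 8 ∅ ∅ := by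
  refine ⟨ed 0 0, mem_edgeSet.2 ⟨0, 0, rfl⟩, by simp, by simp, Or.inr ?_⟩
  intro f hf hfA _
  obtain ⟨i, j, rfl⟩ := mem_edgeSet.1 hf
  constructor
  · rw [← dec_zero]
    exact small_sound (by decide) i j
  · -- use symmetry to reduce to three replies
    obtain ⟨i0, j0, φ, hφ, h00, hij, hw⟩ : ∃ (i0 j0 : Fin 5) (φ : Fin 5 ⊕ Fin 5 ≃ Fin 5 ⊕ Fin 5),
        (∀ e, Sym2.map φ e ∈ (completeBipartiteGraph (Fin 5) (Fin 5)).edgeSet ↔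
          e ∈ (completeBipartiteGraph (Fin 5) (Fin 5)).edgeSet) ∧
        Sym2.map φ (ed 0 0) = ed 0 0 ∧ Sym2.map φ (ed i0 j0) = ed i j ∧
        chk 7 1 (put 0 (5 * i0 + j0)) = true := by
      refine ⟨min i 1, min j 1, Equiv.sumCongr (Equiv.swap (min i 1) i) (Equiv.swap (min j 1) j),
        ?_, ?_, ?_, ?_⟩
      · intro e
        induction e using Sym2.ind with
        | _ x y =>
          rcases x with x | x <;> rcases y with y | y <;>
            simp [completeBipartiteGraph]
      · have h : ∀ k : Fin 5, Equiv.swap (min k 1) k 0 = 0 := by decide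
        simp [ed, h]
      · simp [ed]
      · have h : ¬ (i = 0 ∧ j = 0) := by
          rintro ⟨rfl, rfl⟩
          exact hfA (Set.mem_insert _ _)
        have hm : ∀ k : Fin 5, min k 1 = 0 ∧ k = 0 ∨ min k 1 = 1 := by decide
        rcases hm i with ⟨h1, h1'⟩ | h1 <;> rcases hm j with ⟨h2, h2'⟩ | h2 <;> rw [h1, h2]
        · exact (h ⟨h1', h2'⟩).elim
        · exact chk_row
        · exact chk_col
        · exact chk_diag
    have := win_map φ hφ 7 _ _ (chk_sound _ _ _ hw)
    rw [dec_put, dec_zero, dec_one] at this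
    simpa [h00, hij] using this

theorem wins_five : AliceWins (AchievementGame.star 4) (completeBipartiteGraph (Fin 5) (Fin 5)) := by
  refine aliceWins_of_win (N := 8) (by rw [ncard_edgeSet]; norm_num) ?_ win_start (ed 0 0)
  rintro ⟨f, hf⟩
  exact hf 0 1 (star_adj (0 : Fin 4))

/-! ### Bob's pairing strategy on the board of size four -/

/-- The pairing: every vertex owns a pair of its edges. -/
def mate (p : Fin 4 × Fin 4) : Fin 4 × Fin 4 :=
  if p.1 + p.2 = 0 then (p.1, p.2 + 1)
  else if p.1 + p.2 = 1 then (p.1, p.2 - 1)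
  else if p.1 + p.2 = 2 then (p.1 + 1, p.2)
  else (p.1 - 1, p.2)

theorem mate_mate : ∀ p, mate (mate p) = p := by decide
theorem mate_ne : ∀ p, mate p ≠ p := by decide
theorem mate_row : ∀ i, ∃ j, (mate (i, j)).1 = i := by decide
theorem mate_col : ∀ j, ∃ i, (mate (i, j)).2 = j := by decide

open Classical in
/-- The pairing on edges. -/
noncomputable def mateE (e : Sym2 (Fin 4 ⊕ Fin 4)) : Sym2 (Fin 4 ⊕ Fin 4) :=
  if h : ∃ p : Fin 4 × Fin 4, e = ed p.1 p.2 then ed (mate h.choose).1 (mate h.choose).2 else e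

theorem mateE_ed (p : Fin 4 × Fin 4) : mateE (ed p.1 p.2) = ed (mate p).1 (mate p).2 := by
  have h : ∃ q : Fin 4 × Fin 4, ed p.1 p.2 = ed q.1 q.2 := ⟨p, rfl⟩
  have h2 : h.choose = p := by
    have := ed_inj.1 h.choose_spec
    exact Prod.ext this.1.symm this.2.symm
  rw [mateE, dif_pos h, h2]

open Classical in
/-- Bob's pairing strategy. -/
noncomputable def bobStrat : Strategy (Fin 4 ⊕ Fin 4) := fun l =>
  if mateE (l.getLastD (ed 0 0)) ∈ (completeBipartiteGraph (Fin 4) (Fin 4)).edgeSet ∧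
      mateE (l.getLastD (ed 0 0)) ∉ l then mateE (l.getLastD (ed 0 0))
  else if h : ∃ e ∈ (completeBipartiteGraph (Fin 4) (Fin 4)).edgeSet, e ∉ l then h.choose
  else ed 0 0

theorem bobStrat_valid : bobStrat.Valid (completeBipartiteGraph (Fin 4) (Fin 4)) := by
  intro l hl
  unfold bobStrat
  split_ifs with h
  · exact h
  · exact hl.choose_spec

theorem mateE_mem {e : Sym2 (Fin 4 ⊕ Fin 4)}
    (h : e ∈ (completeBipartiteGraph (Fin 4) (Fin 4)).edgeSet) :
    mateE e ∈ (completeBipartiteGraph (Fin 4) (Fin 4)).edgeSet ∧ mateE e ≠ e ∧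
      mateE (mateE e) = e := by
  obtain ⟨i, j, rfl⟩ := mem_edgeSet.1 h
  have h1 := mateE_ed (i, j)
  simp only at h1
  rw [h1]
  refine ⟨mem_edgeSet.2 ⟨_, _, rfl⟩, fun hc => mate_ne (i, j) ?_, ?_⟩
  · have := ed_inj.1 hc
    exact Prod.ext this.1 this.2
  · rw [mateE_ed, mate_mate]

theorem bob_answers {σ : Strategy (Fin 4 ⊕ Fin 4)}
    (hσ : σ.Valid (completeBipartiteGraph (Fin 4) (Fin 4))) (i : ℕ) (hi : i < 8) :
    move σ bobStrat (2 * i + 1) = mateE (move σ bobStrat (2 * i)) := by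
  induction i using Nat.strong_induction_on with
  | _ i ih =>
    have hv := move_valid hσ bobStrat_valid (i := 2 * i) (by rw [ncard_edgeSet]; omega)
    obtain ⟨hm1, hm2, hm3⟩ := mateE_mem hv.1
    have hlast : (hist σ bobStrat (2 * i + 1)).getLastD (ed 0 0) = move σ bobStrat (2 * i) := by
      rw [hist]
      simp [move]
    have hnot : mateE (move σ bobStrat (2 * i)) ∉ hist σ bobStrat (2 * i + 1) := by
      rw [mem_hist]
      rintro ⟨k, hk, he⟩
      rcases Nat.even_or_odd' k with ⟨c, rfl | rfl⟩
      · rcases Nat.lt_or_ge c i with hc | hc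
        · have h1 := ih c hc (by omega)
          rw [← he, hm3] at h1
          exact hv.2 _ (by omega) h1.symm
        · have : c = i := by omega
          subst this
          exact hm2 he
      · have h1 := ih c (by omega) (by omega)
        have hv' := move_valid hσ bobStrat_valid (i := 2 * c) (by rw [ncard_edgeSet]; omega)
        rw [h1] at he
        have h2 := congrArg mateE he
        rw [hm3, (mateE_mem hv'.1).2.2] at h2
        exact hv.2 _ (by omega) h2
    have : move σ bobStrat (2 * i + 1) = bobStrat (hist σ bobStrat (2 * i + 1)) := by
      unfold move
      rw [if_neg (by omega)]
    rw [this, bobStrat, hlast, if_pos ⟨hm1, hnot⟩]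

theorem not_wins_four : ¬ AliceWins (AchievementGame.star 4) (completeBipartiteGraph (Fin 4) (Fin 4)) := by
  rintro ⟨σ, hσ, h⟩
  obtain ⟨k, hk, hc, _⟩ := h bobStrat bobStrat_valid
  rw [ncard_edgeSet] at hk
  have hmv : ∀ i < 16, _ := fun i hi => move_valid hσ bobStrat_valid (i := i)
    (by rw [ncard_edgeSet]; exact hi)
  obtain ⟨g, hg⟩ := copy_star (by
    rintro e ⟨i, hi, rfl⟩
    exact (hmv _ (by omega)).1) hc
  have hgs : Function.Surjective g := Finite.surjective_of_injective g.injective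
  -- an edge and its mate cannot both be blue
  have key : ∀ p : Fin 4 × Fin 4,
      ed p.1 p.2 ∈ {e | ∃ i ≤ k, e = move σ bobStrat (2 * i)} →
      ed (mate p).1 (mate p).2 ∈ {e | ∃ i ≤ k, e = move σ bobStrat (2 * i)} → False := by
    rintro p ⟨a, ha, h1⟩ ⟨b, hb, h2⟩
    rw [← mateE_ed, h1, ← bob_answers hσ a (by omega)] at h2
    rcases Nat.lt_or_ge (2 * b) (2 * a + 1) with h3 | h3
    · exact (hmv _ (by omega)).2 _ h3 h2
    · exact (hmv _ (by omega)).2 (2 * a + 1) (by omega) h2.symm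
  rcases hg with ⟨i, hi⟩ | ⟨j, hj⟩
  · have hall : ∀ j, ed i j ∈ {e | ∃ i ≤ k, e = move σ bobStrat (2 * i)} := by
      intro j
      obtain ⟨x, rfl⟩ := hgs j
      exact hi x
    obtain ⟨j, hj⟩ := mate_row i
    refine key (i, j) (hall j) ?_
    rw [hj]
    exact hall _
  · have hall : ∀ i, ed i j ∈ {e | ∃ i ≤ k, e = move σ bobStrat (2 * i)} := by
      intro i
      obtain ⟨x, rfl⟩ := hgs i
      exact hj x
    obtain ⟨i, hi⟩ := mate_col j
    refine key (i, j) (hall i) ?_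
    rw [hi]
    exact hall _

theorem four_le {n : ℕ} (h : AliceWins (AchievementGame.star 4) (completeBipartiteGraph (Fin n) (Fin n))) :
    4 ≤ n := by
  obtain ⟨σ, hσ, h⟩ := h
  obtain ⟨k, hk, hc, _⟩ := h σ hσ
  obtain ⟨g, _⟩ := copy_star (by
    rintro e ⟨i, hi, rfl⟩
    exact (move_valid hσ hσ (by omega)).1) hc
  simpa using Fintype.card_le_of_embedding g

end StarFour

/-- The bipartite achievement number of the star with four leaves satisfies
`ba(K_{1,4}) = 5`: the least `n` for which Alice has a winning strategy in
`(K_{1,4}, K_{n,n}, +)` is `5`. In particular Alice has a winning strategy in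
`(K_{1,4}, K_{5,5}, +)` but no winning strategy in `(K_{1,4}, K_{4,4}, +)`. -/
theorem stmt11 :
    IsLeast {n : ℕ | AliceWins (star 4) (completeBipartiteGraph (Fin n) (Fin n))} 5 ∧
    AliceWins (star 4) (completeBipartiteGraph (Fin 5) (Fin 5)) ∧
    ¬ AliceWins (star 4) (completeBipartiteGraph (Fin 4) (Fin 4)) := by
  refine ⟨⟨StarFour.wins_five, fun n hn => ?_⟩, StarFour.wins_five, StarFour.not_wins_four⟩
  have h4 := StarFour.four_le hn
  rcases Nat.lt_or_ge n 5 with h | h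
  · obtain rfl : n = 4 := by omega
    exact (StarFour.not_wins_four hn).elim
  · exact h
end

section
/- For every integer m ≥ 4, the bipartite achievement number of the star satisfies ba(K_{1,m}) ≤ 2m − 3; that is, Alice has a winning strategy in the achievement game (K_{1,m}, K_{2m-3, 2m-3}, +). -/
namespace AchievementGame

/-- cell `c` of the grid lies on line `v` (a row or a column). -/
def onLine {n : ℕ} (v : Fin n ⊕ Fin n) (c : Fin n × Fin n) : Prop :=
  v = Sum.inl c.1 ∨ v = Sum.inr c.2

instance {n : ℕ} (v : Fin n ⊕ Fin n) (c : Fin n × Fin n) : Decidable (onLine v c) := by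
  unfold onLine; infer_instance

/-- number of cells of `S` on the line `v`. -/
def cnt {n : ℕ} (S : Finset (Fin n × Fin n)) (v : Fin n ⊕ Fin n) : ℕ :=
  (S.filter (onLine v)).card

/-- some line contains at least `m` cells of `S`. -/
def Big {n : ℕ} (m : ℕ) (S : Finset (Fin n × Fin n)) : Prop := ∃ v, m ≤ cnt S v

/-- Alice, to move, wins in the position with her cells `A` and Bob's cells `B`. -/
inductive Wins {n : ℕ} (m : ℕ) : Finset (Fin n × Fin n) → Finset (Fin n × Fin n) → Prop
  | win (e : Fin n × Fin n) (A B : Finset (Fin n × Fin n)) : e ∉ A → e ∉ B →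
      Big m (insert e A) → Wins m A B
  | step (e : Fin n × Fin n) (A B : Finset (Fin n × Fin n)) : e ∉ A → e ∉ B →
      (∃ f, f ∉ insert e A ∧ f ∉ B) →
      (∀ f, f ∉ insert e A → f ∉ B → ¬ Big m (insert f B)) →
      (∀ f, f ∉ insert e A → f ∉ B → Wins m (insert e A) (insert f B)) → Wins m A B

theorem cnt_empty {n : ℕ} (v : Fin n ⊕ Fin n) : cnt ∅ v = 0 := by simp [cnt]

theorem cnt_insert {n : ℕ} {a : Fin n × Fin n} {S : Finset (Fin n × Fin n)} (h : a ∉ S)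
    (v : Fin n ⊕ Fin n) : cnt (insert a S) v = cnt S v + if onLine v a then 1 else 0 := by
  unfold cnt
  rw [Finset.filter_insert]
  split_ifs with h1
  · rw [Finset.card_insert_of_notMem]
    simp [h]
  · simp

theorem cnt_insert_le {n : ℕ} (a : Fin n × Fin n) (S : Finset (Fin n × Fin n))
    (v : Fin n ⊕ Fin n) : cnt (insert a S) v ≤ cnt S v + if onLine v a then 1 else 0 := by
  by_cases h : a ∈ S
  · rw [Finset.insert_eq_of_mem h]; omega
  · rw [cnt_insert h]

theorem cnt_mono {n : ℕ} (a : Fin n × Fin n) (S : Finset (Fin n × Fin n))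
    (v : Fin n ⊕ Fin n) : cnt S v ≤ cnt (insert a S) v := by
  unfold cnt
  apply Finset.card_le_card
  apply Finset.filter_subset_filter
  simp

theorem cnt_univ {n : ℕ} (v : Fin n ⊕ Fin n) : cnt Finset.univ v = n := by
  unfold cnt
  rcases v with x | y
  · have : (Finset.univ.filter (onLine (Sum.inl x)) : Finset (Fin n × Fin n))
        = Finset.univ.image (fun j => (x, j)) := by
      ext ⟨a, b⟩; simp [onLine]
    rw [this, Finset.card_image_of_injective _ (by intro a b; simp)]; simp
  · have : (Finset.univ.filter (onLine (Sum.inr y)) : Finset (Fin n × Fin n))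
        = Finset.univ.image (fun j => (j, y)) := by
      ext ⟨a, b⟩; simp [onLine, eq_comm]
    rw [this, Finset.card_image_of_injective _ (by intro a b; simp)]; simp

theorem exists_free_line {n : ℕ} (A B : Finset (Fin n × Fin n)) (v : Fin n ⊕ Fin n)
    (h : cnt A v + cnt B v < n) : ∃ e, onLine v e ∧ e ∉ A ∧ e ∉ B := by
  by_contra hc
  push Not at hc
  have h1 : cnt Finset.univ v ≤ cnt A v + cnt B v := by
    unfold cnt
    refine le_trans (Finset.card_le_card ?_) (Finset.card_union_le _ _)
    intro e he
    simp only [Finset.mem_filter, Finset.mem_univ, true_and, Finset.mem_union] at he ⊢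
    have := hc e he
    tauto
  rw [cnt_univ] at h1
  omega

theorem exists_free {n : ℕ} (A B : Finset (Fin n × Fin n))
    (h : A.card + B.card < n * n) : ∃ e, e ∉ A ∧ e ∉ B := by
  by_contra hc
  push Not at hc
  have h1 : (Finset.univ : Finset (Fin n × Fin n)).card ≤ A.card + B.card := by
    refine le_trans (Finset.card_le_card ?_) (Finset.card_union_le _ _)
    intro e he
    have := hc e
    rw [Finset.mem_union]
    tauto
  simp at h1
  omega

theorem not_big {n m k : ℕ} {S : Finset (Fin n × Fin n)} (h : ∀ v, cnt S v ≤ k) (hk : k < m) :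
    ¬ Big m S := by
  rintro ⟨v, hv⟩
  have := h v
  omega

/-- The race: Alice to move, two ahead on `v`, and Bob nowhere beyond her count on `v`. -/
theorem race {n m : ℕ} (hn : n = 2 * m - 3) (v : Fin n ⊕ Fin n) :
    ∀ (d : ℕ) (A B : Finset (Fin n × Fin n)), cnt A v + d + 1 = m → cnt B v + 2 ≤ cnt A v →
      (∀ w, cnt B w ≤ cnt A v) → Wins m A B := by
  intro d
  induction d with
  | zero =>
    intro A B h1 h2 h3
    obtain ⟨e, hv, hA, hB⟩ := exists_free_line A B v (by omega)
    refine Wins.win e A B hA hB ⟨v, ?_⟩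
    rw [cnt_insert hA, if_pos hv]; omega
  | succ d ih =>
    intro A B h1 h2 h3
    obtain ⟨e, hv, hA, hB⟩ := exists_free_line A B v (by omega)
    have hc : cnt (insert e A) v = cnt A v + 1 := by rw [cnt_insert hA, if_pos hv]
    have hins : ∀ f w, cnt (insert f B) w ≤ cnt B w + 1 := by
      intro f w
      have := cnt_insert_le f B w
      split_ifs at this <;> omega
    refine Wins.step e A B hA hB ?_ ?_ ?_
    · obtain ⟨f, -, h⟩ := exists_free_line (insert e A) B v (by omega)
      exact ⟨f, h⟩
    · intro f _ _
      refine not_big (k := cnt A v + 1) (fun w => ?_) (by omega)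
      have := hins f w; have := h3 w; omega
    · intro f _ _
      refine ih _ _ (by omega) ?_ ?_
      · have := hins f v; omega
      · intro w
        have := hins f w; have := h3 w; omega

theorem race' {n m : ℕ} (hn : n = 2 * m - 3) (v : Fin n ⊕ Fin n) 
    (A B : Finset (Fin n × Fin n)) (k : ℕ) (hk : k < m) (h1 : cnt A v = k) (h2 : cnt B v + 2 ≤ k)
    (h3 : ∀ w, cnt B w ≤ k) : Wins m A B :=
  race hn v (m - k - 1) A B (by omega) (by omega) (by simpa [h1] using h3)

theorem fresh {n : ℕ} (hn : 4 ≤ n) (a b c : Fin n) : ∃ r, r ≠ a ∧ r ≠ b ∧ r ≠ c := by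
  by_contra h
  push Not at h
  have : (Finset.univ : Finset (Fin n)) ⊆ {a, b, c} := by
    intro r _
    have := h r
    simp only [Finset.mem_insert, Finset.mem_singleton]
    tauto
  have := Finset.card_le_card this
  have h3 : ({a, b, c} : Finset (Fin n)).card ≤ 3 := Finset.card_le_three
  simp at this
  omega

theorem free54 {n : ℕ} (hn : 5 ≤ n) (a b c d e f g h i : Fin n × Fin n) :
    ∃ x, x ∉ ({a, b, c, d, e} : Finset (Fin n × Fin n)) ∧
      x ∉ ({f, g, h, i} : Finset (Fin n × Fin n)) := by
  apply exists_free
  have h1 : ({a, b, c, d, e} : Finset (Fin n × Fin n)).card ≤ 5 := Finset.card_le_five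
  have h2 : ({f, g, h, i} : Finset (Fin n × Fin n)).card ≤ 4 := Finset.card_le_four
  nlinarith

set_option linter.unusedSimpArgs false
set_option linter.unnecessarySeqFocus false
set_option linter.flexible false

set_option maxHeartbeats 2000000 in
/-- Final double threat: rows `u`, `i`, `w`, `r`, columns `p`, `q`, `z`, `c`. -/
theorem stage5a {n m : ℕ} (hm : 4 ≤ m) (hn : n = 2 * m - 3) (u i w r p q z c b₁ b₂ : Fin n)
    (hui : u ≠ i) (huw : u ≠ w) (hiw : i ≠ w) (hru : r ≠ u) (hri : r ≠ i) (hrw : r ≠ w)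
    (hpq : p ≠ q) (hpz : p ≠ z) (hqz : q ≠ z) (hcp : c ≠ p) (hcq : c ≠ q) (hcz : c ≠ z)
    (h1 : b₁ ≠ r) (h2 : b₂ ≠ q) :
    Wins m {(r, c), (i, q), (u, q), (u, p)} {(b₁, b₂), (w, q), (u, z), (i, p)} := by
  have key : ∀ f : Fin n × Fin n, ∀ v,
      cnt {f, (b₁, b₂), (w, q), (u, z), (i, p)} v ≤
      (if onLine v f then 1 else 0) + (if onLine v (b₁, b₂) then 1 else 0) +
       (if onLine v (w, q) then 1 else 0) + (if onLine v (u, z) then 1 else 0) +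
        (if onLine v (i, p) then 1 else 0) := by
    intro f v
    have e1 := cnt_insert_le f {(b₁, b₂), (w, q), (u, z), (i, p)} v
    have e2 := cnt_insert_le (b₁, b₂) {(w, q), (u, z), (i, p)} v
    have e3 := cnt_insert_le (w, q) {(u, z), (i, p)} v
    have e4 := cnt_insert_le (u, z) {(i, p)} v
    have e5 := cnt_insert_le (i, p) ∅ v
    have e6 := cnt_empty v
    simp only [insert_empty_eq] at e5
    omega
  have key3 : ∀ f : Fin n × Fin n, ∀ v, cnt {f, (b₁, b₂), (w, q), (u, z), (i, p)} v ≤ 3 := by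
    intro f v
    refine (key f v).trans ?_
    rcases v with x | y <;> simp only [onLine, Sum.inl.injEq, Sum.inr.injEq, reduceCtorEq, false_or, or_false] <;> grind
  have keyA : ∀ v, cnt {(r, q), (r, c), (i, q), (u, q), (u, p)} v =
      (if onLine v (r, q) then 1 else 0) + (if onLine v (r, c) then 1 else 0) +
       (if onLine v (i, q) then 1 else 0) + (if onLine v (u, q) then 1 else 0) +
        (if onLine v (u, p) then 1 else 0) := by
    intro v
    rw [cnt_insert (by simp only [Finset.mem_insert, Finset.mem_singleton, Finset.notMem_empty, Prod.mk.injEq]; grind), cnt_insert (by simp only [Finset.mem_insert, Finset.mem_singleton, Finset.notMem_empty, Prod.mk.injEq]; grind), cnt_insert (by simp only [Finset.mem_insert, Finset.mem_singleton, Finset.notMem_empty, Prod.mk.injEq]; grind),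
      cnt_insert (by simp only [Finset.mem_insert, Finset.mem_singleton, Finset.notMem_empty, Prod.mk.injEq]; grind), ← insert_empty_eq, cnt_insert (by simp only [Finset.mem_insert, Finset.mem_singleton, Finset.notMem_empty, Prod.mk.injEq]; grind), cnt_empty]
    omega
  refine Wins.step (r, q) _ _ (by simp only [Finset.mem_insert, Finset.mem_singleton, Finset.notMem_empty, Prod.mk.injEq]; grind) (by simp only [Finset.mem_insert, Finset.mem_singleton, Finset.notMem_empty, Prod.mk.injEq]; grind) ?_ ?_ ?_
  · exact free54 (by omega) _ _ _ _ _ _ _ _ _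
  · intro f _ _
    exact not_big (key3 f) (by omega)
  · rintro ⟨f₁, f₂⟩ hfA hfB
    by_cases hf : f₂ = q
    · subst hf
      refine race' hn (Sum.inl r) _ _ 2 (by omega) ?_ ?_ ?_
      · rw [keyA]; simp [onLine]; grind
      · have := key (f₁, f₂) (Sum.inl r)
        simp [onLine] at this; grind
      · intro v
        refine (key _ v).trans ?_
        rcases v with x | y <;> simp only [onLine, Sum.inl.injEq, Sum.inr.injEq, reduceCtorEq, false_or, or_false] <;> grind
    · refine race' hn (Sum.inr q) _ _ 3 (by omega) ?_ ?_ (key3 _)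
      · rw [keyA]; simp [onLine]; grind
      · have := key (f₁, f₂) (Sum.inr q)
        simp [onLine] at this; grind

theorem cnt_swap {n : ℕ} (A : Finset (Fin n × Fin n)) (v : Fin n ⊕ Fin n) :
    cnt (A.image Prod.swap) v = cnt A v.swap := by
  unfold cnt
  rw [Finset.filter_image, Finset.card_image_of_injective _ Prod.swap_injective]
  congr 1
  ext ⟨a, b⟩
  rw [Finset.mem_filter, Finset.mem_filter]
  rcases v with x | y <;> simp [onLine]

theorem big_swap {n m : ℕ} (A : Finset (Fin n × Fin n)) :
    Big m (A.image Prod.swap) ↔ Big m A := by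
  constructor
  · rintro ⟨v, hv⟩
    rw [cnt_swap] at hv
    exact ⟨_, hv⟩
  · rintro ⟨v, hv⟩
    refine ⟨v.swap, ?_⟩
    rw [cnt_swap, Sum.swap_swap]
    exact hv

theorem mem_swap {n : ℕ} (A : Finset (Fin n × Fin n)) (e : Fin n × Fin n) :
    e ∈ A.image Prod.swap ↔ e.swap ∈ A := by
  obtain ⟨a, b⟩ := e
  simp only [Finset.mem_image, Prod.exists, Prod.swap_prod_mk, Prod.mk.injEq]
  constructor
  · rintro ⟨x, y, h, rfl, rfl⟩
    exact h
  · intro h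
    exact ⟨b, a, h, rfl, rfl⟩

theorem wins_swap {n m : ℕ} {A B : Finset (Fin n × Fin n)} (h : Wins m A B) :
    Wins m (A.image Prod.swap) (B.image Prod.swap) := by
  induction h with
  | win e A B hA hB hw =>
    refine Wins.win e.swap _ _ (by rwa [mem_swap]) (by rwa [mem_swap]) ?_
    rw [← Finset.image_insert, big_swap]
    exact hw
  | step e A B hA hB hf hn _ ih =>
    refine Wins.step e.swap _ _ (by rwa [mem_swap]) (by rwa [mem_swap]) ?_ ?_ ?_
    · obtain ⟨f, h1, h2⟩ := hf
      refine ⟨f.swap, ?_, by rwa [mem_swap]⟩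
      rw [← Finset.image_insert, mem_swap]
      exact h1
    · intro f h1 h2
      rw [← Finset.image_insert, mem_swap] at h1
      rw [mem_swap] at h2
      have := hn f.swap h1 h2
      rw [← big_swap, Finset.image_insert, Prod.swap_swap] at this
      exact this
    · intro f h1 h2
      rw [← Finset.image_insert, mem_swap] at h1
      rw [mem_swap] at h2
      have := ih f.swap h1 h2
      rw [Finset.image_insert, Finset.image_insert, Prod.swap_swap] at this
      exact this

theorem stage5b {n m : ℕ} (hm : 4 ≤ m) (hn : n = 2 * m - 3) (u i w r p q z c b₁ b₂ : Fin n)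
    (hui : u ≠ i) (huw : u ≠ w) (hiw : i ≠ w) (hru : r ≠ u) (hri : r ≠ i) (hrw : r ≠ w)
    (hpq : p ≠ q) (hpz : p ≠ z) (hqz : q ≠ z) (hcp : c ≠ p) (hcq : c ≠ q) (hcz : c ≠ z)
    (h1 : b₁ ≠ u) (h2 : b₂ ≠ c) :
    Wins m {(r, c), (i, q), (u, q), (u, p)} {(b₁, b₂), (w, q), (u, z), (i, p)} := by
  have h := wins_swap (stage5a hm hn q p z c i u w r b₂ b₁ hpq.symm hqz hpz hcq hcp hcz
    hui.symm hiw huw hri hru hrw h2 h1)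
  convert h using 1
  · ext ⟨x, y⟩
    simp only [Finset.image_insert, Finset.image_singleton, Prod.swap_prod_mk, Finset.mem_insert,
      Finset.mem_singleton]
    tauto
  · ext ⟨x, y⟩
    simp only [Finset.image_insert, Finset.image_singleton, Prod.swap_prod_mk, Finset.mem_insert,
      Finset.mem_singleton]
    tauto

theorem cnt4_le {n : ℕ} (a b c d : Fin n × Fin n) (v : Fin n ⊕ Fin n) :
    cnt {a, b, c, d} v ≤ (if onLine v a then 1 else 0) + (if onLine v b then 1 else 0) +
      (if onLine v c then 1 else 0) + (if onLine v d then 1 else 0) := by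
  have e2 := cnt_insert_le a {b, c, d} v
  have e3 := cnt_insert_le b {c, d} v
  have e4 := cnt_insert_le c {d} v
  have e5 := cnt_insert_le d ∅ v
  have e6 := cnt_empty v
  simp only [insert_empty_eq] at e5
  omega

theorem cnt3_le {n : ℕ} (a b c : Fin n × Fin n) (v : Fin n ⊕ Fin n) :
    cnt {a, b, c} v ≤ (if onLine v a then 1 else 0) + (if onLine v b then 1 else 0) +
      (if onLine v c then 1 else 0) := by
  have e3 := cnt_insert_le a {b, c} v
  have e4 := cnt_insert_le b {c} v
  have e5 := cnt_insert_le c ∅ v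
  have e6 := cnt_empty v
  simp only [insert_empty_eq] at e5
  omega

theorem cnt2_le {n : ℕ} (a b : Fin n × Fin n) (v : Fin n ⊕ Fin n) :
    cnt {a, b} v ≤ (if onLine v a then 1 else 0) + (if onLine v b then 1 else 0) := by
  have e4 := cnt_insert_le a {b} v
  have e5 := cnt_insert_le b ∅ v
  have e6 := cnt_empty v
  simp only [insert_empty_eq] at e5
  omega

set_option maxHeartbeats 2000000 in
theorem stage4 {n m : ℕ} (hm : 4 ≤ m) (hn : n = 2 * m - 3) (u i w p q z : Fin n)
    (hui : u ≠ i) (huw : u ≠ w) (hiw : i ≠ w) (hpq : p ≠ q) (hpz : p ≠ z) (hqz : q ≠ z) :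
    Wins m {(i, q), (u, q), (u, p)} {(w, q), (u, z), (i, p)} := by
  obtain ⟨r, hru, hri, hrw⟩ := fresh (by omega) u i w
  obtain ⟨c, hcp, hcq, hcz⟩ := fresh (by omega) p q z
  refine Wins.step (r, c) _ _ (by simp only [Finset.mem_insert, Finset.mem_singleton, Finset.notMem_empty, Prod.mk.injEq]; grind) (by simp only [Finset.mem_insert, Finset.mem_singleton, Finset.notMem_empty, Prod.mk.injEq]; grind) ?_ ?_ ?_
  · obtain ⟨x, h1, h2⟩ := free54 (by omega) (r, c) (i, q) (u, q) (u, p) (u, p) (w, q) (w, q) (u, z) (i, p)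
    refine ⟨x, ?_, ?_⟩
    · simpa using h1
    · simpa using h2
  · intro f _ _
    refine not_big (k := 2) (fun v => (cnt4_le _ _ _ _ v).trans ?_) (by omega)
    rcases v with x | y <;> simp only [onLine, Sum.inl.injEq, Sum.inr.injEq, reduceCtorEq, false_or, or_false] <;> grind
  · rintro ⟨b₁, b₂⟩ hA hB
    simp only [Finset.mem_insert, Finset.mem_singleton, Finset.notMem_empty, Prod.mk.injEq] at hA
    by_cases h : b₁ ≠ r ∧ b₂ ≠ q
    · exact stage5a hm hn u i w r p q z c b₁ b₂ hui huw hiw hru hri hrw hpq hpz hqz hcp hcq hcz h.1 h.2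
    · apply stage5b hm hn u i w r p q z c b₁ b₂ hui huw hiw hru hri hrw hpq hpz hqz hcp hcq hcz
      · grind
      · grind

set_option maxHeartbeats 2000000 in
theorem stage3 {n m : ℕ} (hm : 4 ≤ m) (hn : n = 2 * m - 3) (u i p q z : Fin n)
    (hui : u ≠ i) (hpq : p ≠ q) (hpz : p ≠ z) (hqz : q ≠ z) :
    Wins m {(u, q), (u, p)} {(u, z), (i, p)} := by
  have key : ∀ f v, cnt {f, (u, z), (i, p)} v ≤ 2 := by
    intro f v
    refine (cnt3_le _ _ _ v).trans ?_
    rcases v with x | y <;> simp only [onLine, Sum.inl.injEq, Sum.inr.injEq, reduceCtorEq, false_or, or_false] <;> grind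
  refine Wins.step (i, q) _ _ (by simp only [Finset.mem_insert, Finset.mem_singleton, Finset.notMem_empty, Prod.mk.injEq]; grind) (by simp only [Finset.mem_insert, Finset.mem_singleton, Finset.notMem_empty, Prod.mk.injEq]; grind) ?_ ?_ ?_
  · obtain ⟨x, h1, h2⟩ := free54 (by omega) (i, q) (u, q) (u, p) (u, p) (u, p) (u, z) (u, z) (u, z) (i, p)
    refine ⟨x, ?_, ?_⟩
    · simpa using h1
    · simpa using h2
  · intro f _ _
    exact not_big (key f) (by omega)
  · rintro ⟨w, b₂⟩ hA hB
    simp only [Finset.mem_insert, Finset.mem_singleton, Finset.notMem_empty, Prod.mk.injEq] at hA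
    by_cases h : b₂ = q
    · subst h
      apply stage4 hm hn u i w p b₂ z hui _ _ hpq hpz hqz
      · grind
      · grind
    · refine race' hn (Sum.inr q) _ _ 2 (by omega) ?_ ?_ (key _)
      · rw [cnt_insert (by simp only [Finset.mem_insert, Finset.mem_singleton, Finset.notMem_empty, Prod.mk.injEq]; grind), cnt_insert (by simp only [Finset.mem_insert, Finset.mem_singleton, Finset.notMem_empty, Prod.mk.injEq]; grind),
          ← insert_empty_eq, cnt_insert (by simp), cnt_empty]
        simp only [onLine, Sum.inl.injEq, Sum.inr.injEq, reduceCtorEq, false_or, or_false]; grind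
      · have := cnt3_le (w, b₂) (u, z) (i, p) (Sum.inr q)
        simp only [onLine, Sum.inl.injEq, Sum.inr.injEq, reduceCtorEq, false_or, or_false] at this; grind

set_option maxHeartbeats 2000000 in
theorem stage2 {n m : ℕ} (hm : 4 ≤ m) (hn : n = 2 * m - 3) (u i p q : Fin n)
    (hui : u ≠ i) (hpq : p ≠ q) (f : Fin n × Fin n) 
    (hA : f ∉ ({(u, q), (u, p)} : Finset (Fin n × Fin n))) :
    Wins m {(u, q), (u, p)} {f, (i, p)} := by
  obtain ⟨b₁, z⟩ := f
  simp only [Finset.mem_insert, Finset.mem_singleton, Finset.notMem_empty, Prod.mk.injEq] at hA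
  by_cases h : b₁ = u
  · subst h
    apply stage3 hm hn b₁ i p q z hui hpq
    · grind
    · grind
  · refine race' hn (Sum.inl u) _ _ 2 (by omega) ?_ ?_ ?_
    · rw [cnt_insert (by simp only [Finset.mem_insert, Finset.mem_singleton, Finset.notMem_empty, Prod.mk.injEq]; grind),
          ← insert_empty_eq, cnt_insert (by simp), cnt_empty]
      simp only [onLine, Sum.inl.injEq, Sum.inr.injEq, reduceCtorEq, false_or, or_false]; grind
    · have := cnt2_le (b₁, z) (i, p) (Sum.inl u)
      simp only [onLine, Sum.inl.injEq, Sum.inr.injEq, reduceCtorEq, false_or, or_false] at this; grind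
    · intro v
      have := cnt2_le (b₁, z) (i, p) v
      grind

theorem stage1 {n m : ℕ} (hm : 4 ≤ m) (hn : n = 2 * m - 3) (u p b₁ b₂ : Fin n) (h : b₁ ≠ u) :
    Wins m {(u, p)} {(b₁, b₂)} := by
  have hfree : ∀ e : Fin n × Fin n, ∃ f, f ∉ insert e ({(u, p)} : Finset (Fin n × Fin n)) ∧
      f ∉ ({(b₁, b₂)} : Finset (Fin n × Fin n)) := by
    intro e
    obtain ⟨x, h1, h2⟩ := free54 (by omega) e (u, p) (u, p) (u, p) (u, p) (b₁, b₂) (b₁, b₂) (b₁, b₂) (b₁, b₂)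
    refine ⟨x, ?_, ?_⟩
    · simpa using h1
    · simpa using h2
  have hbig : ∀ f : Fin n × Fin n, ¬ Big m ({f, (b₁, b₂)} : Finset (Fin n × Fin n)) := by
    intro f
    refine not_big (k := 2) (fun v => ?_) (by omega)
    have := cnt2_le f (b₁, b₂) v
    grind
  by_cases hp : b₂ = p
  · subst hp
    obtain ⟨q, hq, -, -⟩ := fresh (by omega) b₂ b₂ b₂
    refine Wins.step (u, q) _ _ (by simp only [Finset.mem_insert, Finset.mem_singleton, Finset.notMem_empty, Prod.mk.injEq]; grind) (by simp only [Finset.mem_insert, Finset.mem_singleton, Finset.notMem_empty, Prod.mk.injEq]; grind)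
      (hfree _) (fun f _ _ => hbig f) ?_
    intro f hA _
    exact stage2 hm hn u b₁ b₂ q h.symm hq.symm f hA
  · refine Wins.step (u, b₂) _ _ (by simp only [Finset.mem_insert, Finset.mem_singleton, Finset.notMem_empty, Prod.mk.injEq]; grind) (by simp only [Finset.mem_insert, Finset.mem_singleton, Finset.notMem_empty, Prod.mk.injEq]; grind)
      (hfree _) (fun f _ _ => hbig f) ?_
    intro f hA _
    have := stage2 hm hn u b₁ b₂ p h.symm hp f (by rw [Finset.pair_comm]; exact hA)
    rw [Finset.pair_comm (u, p)] at this
    exact this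

theorem wins_start {n m : ℕ} (hm : 4 ≤ m) (hn : n = 2 * m - 3) :
    Wins m (∅ : Finset (Fin n × Fin n)) ∅ := by
  obtain ⟨o⟩ : Nonempty (Fin n) := ⟨⟨0, by omega⟩⟩
  refine Wins.step (o, o) _ _ (by simp) (by simp) ?_ ?_ ?_
  · obtain ⟨x, h1, h2⟩ := free54 (by omega) (o, o) (o, o) (o, o) (o, o) (o, o) (o, o) (o, o) (o, o) (o, o)
    exact ⟨x, by simpa using h1, by simp⟩
  · intro f _ _
    refine not_big (k := 1) (fun v => ?_) (by omega)
    have := cnt_insert_le f ∅ v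
    have := cnt_empty v
    grind
  · rintro ⟨b₁, b₂⟩ hA _
    simp only [Finset.mem_insert, Finset.mem_singleton, Finset.notMem_empty, Prod.mk.injEq, insert_empty_eq] at hA ⊢
    by_cases h : b₁ = o
    · have h2 : b₂ ≠ o := by grind
      have := wins_swap (stage1 hm hn o o b₂ b₁ h2)
      simpa using this
    · exact stage1 hm hn o o b₁ b₂ h

/-- the edge of the complete bipartite graph belonging to a cell. -/
def cellEdge {n : ℕ} (c : Fin n × Fin n) : Sym2 (Fin n ⊕ Fin n) := s(Sum.inl c.1, Sum.inr c.2)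

theorem cellEdge_inj {n : ℕ} {c d : Fin n × Fin n} : cellEdge c = cellEdge d ↔ c = d := by
  obtain ⟨a, b⟩ := c
  obtain ⟨a', b'⟩ := d
  simp [cellEdge]

theorem mem_edges {n : ℕ} (e : Sym2 (Fin n ⊕ Fin n)) :
    e ∈ (completeBipartiteGraph (Fin n) (Fin n)).edgeSet ↔ ∃ c, e = cellEdge c := by
  induction e using Sym2.ind with
  | _ x y =>
    rw [SimpleGraph.mem_edgeSet]
    rcases x with x | x <;> rcases y with y | y <;> simp [cellEdge]

open Classical in
/-- cells played at the positions `2 * i + k` of the history. -/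
noncomputable def cells {n : ℕ} (k : ℕ) (l : List (Sym2 (Fin n ⊕ Fin n))) :
    Finset (Fin n × Fin n) :=
  Finset.univ.filter (fun c => ∃ i, l[2 * i + k]? = some (cellEdge c))

theorem mem_cells {n : ℕ} (k : ℕ) (l : List (Sym2 (Fin n ⊕ Fin n))) (c : Fin n × Fin n) :
    c ∈ cells k l ↔ ∃ i, l[2 * i + k]? = some (cellEdge c) := by
  simp [cells]

theorem notMem_list {n : ℕ} (l : List (Sym2 (Fin n ⊕ Fin n))) (c : Fin n × Fin n) :
    cellEdge c ∉ l ↔ c ∉ cells 0 l ∧ c ∉ cells 1 l := by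
  rw [← not_or, not_iff_not, mem_cells, mem_cells, List.mem_iff_getElem?]
  constructor
  · rintro ⟨i, hi⟩
    rcases Nat.even_or_odd' i with ⟨j, rfl | rfl⟩
    · exact Or.inl ⟨j, hi⟩
    · exact Or.inr ⟨j, hi⟩
  · rintro (⟨i, hi⟩ | ⟨i, hi⟩)
    · exact ⟨_, hi⟩
    · exact ⟨_, hi⟩

theorem cells_append {n t : ℕ} (l : List (Sym2 (Fin n ⊕ Fin n))) (hl : l.length = 2 * t)
    (e f : Fin n × Fin n) :
    cells 0 (l ++ [cellEdge e] ++ [cellEdge f]) = insert e (cells 0 l) ∧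
    cells 1 (l ++ [cellEdge e] ++ [cellEdge f]) = insert f (cells 1 l) := by
  have key : ∀ j, (l ++ [cellEdge e] ++ [cellEdge f])[j]? =
      if j < 2 * t then l[j]? else if j = 2 * t then some (cellEdge e) else
        if j = 2 * t + 1 then some (cellEdge f) else none := by
    intro j
    simp only [List.getElem?_append, List.length_append, List.length_singleton, hl,
      List.getElem?_singleton]
    split_ifs <;> first | rfl | omega
  constructor
  · ext c
    rw [Finset.mem_insert, mem_cells, mem_cells]
    constructor
    · rintro ⟨i, hi⟩
      rw [key] at hi
      split_ifs at hi with h1 h2 h3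
      · exact Or.inr ⟨i, hi⟩
      · left
        rw [Option.some.injEq, cellEdge_inj] at hi
        exact hi.symm
      · omega
    · rintro (rfl | ⟨i, hi⟩)
      · refine ⟨t, ?_⟩
        rw [key]
        simp
      · refine ⟨i, ?_⟩
        have : 2 * i + 0 < l.length := by
          by_contra h
          rw [List.getElem?_eq_none (by omega)] at hi
          simp at hi
        rw [key, if_pos (by omega), hi]
  · ext c
    rw [Finset.mem_insert, mem_cells, mem_cells]
    constructor
    · rintro ⟨i, hi⟩
      rw [key] at hi
      split_ifs at hi with h1 h2 h3
      · exact Or.inr ⟨i, hi⟩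
      · omega
      · left
        rw [Option.some.injEq, cellEdge_inj] at hi
        exact hi.symm
    · rintro (rfl | ⟨i, hi⟩)
      · refine ⟨t, ?_⟩
        rw [key]
        simp
      · refine ⟨i, ?_⟩
        have : 2 * i + 1 < l.length := by
          by_contra h
          rw [List.getElem?_eq_none (by omega)] at hi
          simp at hi
        rw [key, if_pos (by omega), hi]

theorem hist_length {α : Type*} (σ τ : Strategy α) (t : ℕ) : (hist σ τ t).length = t := by
  induction t with
  | zero => rfl
  | succ t ih => simp [hist, ih]

theorem hist_get {α : Type*} (σ τ : Strategy α) (t i : ℕ) (h : i < t) :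
    (hist σ τ t)[i]? = some (move σ τ i) := by
  induction t with
  | zero => omega
  | succ t ih =>
    have hl := hist_length σ τ t
    simp only [hist]
    rcases Nat.lt_or_ge i t with h1 | h1
    · rw [List.getElem?_append_left (by omega), ih h1]
    · obtain rfl : i = t := by omega
      rw [List.getElem?_append_right (by omega), hl]
      simp [move]

theorem hasCopy_of_big {n m : ℕ} (S : Finset (Fin n × Fin n)) (s : Set (Sym2 (Fin n ⊕ Fin n)))
    (hS : ∀ c ∈ S, cellEdge c ∈ s) (h : Big m S) : HasCopy (star m) s := by
  obtain ⟨v, hv⟩ := h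
  unfold cnt at hv
  have main : ∃ g : Fin m ↪ Fin n ⊕ Fin n, ∀ k, g k ≠ v ∧ s(v, g k) ∈ s := by
    have e0 : Fin m ↪ {x // x ∈ S.filter (onLine v)} := by
      refine (Fin.castLEEmb hv).trans ?_
      exact (Finset.equivFin _).symm.toEmbedding
    rcases v with x | y
    · refine ⟨⟨fun k => Sum.inr (e0 k).1.2, ?_⟩, ?_⟩
      · intro a b hab
        have ha := (Finset.mem_filter.1 (e0 a).2).2
        have hb := (Finset.mem_filter.1 (e0 b).2).2
        simp only [onLine, Sum.inl.injEq, reduceCtorEq, or_false] at ha hb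
        simp only [Sum.inr.injEq] at hab
        apply e0.injective
        apply Subtype.ext
        exact Prod.ext (ha.symm.trans hb) hab
      · intro k
        have hk := Finset.mem_filter.1 (e0 k).2
        have := hS _ hk.1
        have h2 := hk.2
        simp only [onLine, Sum.inl.injEq, reduceCtorEq, or_false] at h2
        refine ⟨by simp, ?_⟩
        rw [cellEdge, ← h2] at this
        exact this
    · refine ⟨⟨fun k => Sum.inl (e0 k).1.1, ?_⟩, ?_⟩
      · intro a b hab
        have ha := (Finset.mem_filter.1 (e0 a).2).2
        have hb := (Finset.mem_filter.1 (e0 b).2).2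
        simp only [onLine, Sum.inr.injEq, reduceCtorEq, false_or] at ha hb
        simp only [Sum.inl.injEq] at hab
        apply e0.injective
        apply Subtype.ext
        exact Prod.ext hab (ha.symm.trans hb)
      · intro k
        have hk := Finset.mem_filter.1 (e0 k).2
        have := hS _ hk.1
        have h2 := hk.2
        simp only [onLine, Sum.inr.injEq, reduceCtorEq, false_or] at h2
        refine ⟨by simp, ?_⟩
        rw [cellEdge, ← h2, Sym2.eq_swap] at this
        exact this
  obtain ⟨g, hg⟩ := main
  refine ⟨⟨Fin.cons v g, ?_⟩, ?_⟩
  · rw [Fin.cons_injective_iff]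
    refine ⟨?_, g.injective⟩
    rintro ⟨k, hk⟩
    exact (hg k).1 hk
  · intro a b hab
    simp only [star, SimpleGraph.fromRel_adj] at hab
    obtain ⟨hne, rfl | rfl⟩ := hab
    · obtain ⟨k, rfl⟩ := Fin.exists_succ_eq.2 hne.symm
      simpa using (hg k).2
    · obtain ⟨k, rfl⟩ := Fin.exists_succ_eq.2 hne
      rw [Sym2.eq_swap]
      simpa using (hg k).2

theorem big_of_hasCopy {n m : ℕ} (S : Finset (Fin n × Fin n)) (s : Set (Sym2 (Fin n ⊕ Fin n)))
    (hS : ∀ e ∈ s, ∃ c ∈ S, e = cellEdge c) (h : HasCopy (star m) s) : Big m S := by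
  obtain ⟨f, hf⟩ := h
  have h1 : ∀ k : Fin m, ∃ c ∈ S, s(f 0, f k.succ) = cellEdge c := by
    intro k
    apply hS
    apply hf
    simp only [star, SimpleGraph.fromRel_adj]
    exact ⟨(Fin.succ_ne_zero k).symm, by simp⟩
  choose g hgS hg using h1
  refine ⟨f 0, ?_⟩
  unfold cnt
  have hinj : Function.Injective g := by
    intro a b hab
    have h2 := (hg a).trans ((congrArg cellEdge hab).trans (hg b).symm)
    rw [Sym2.congr_right] at h2
    exact Fin.succ_injective _ (f.injective h2)
  have : (Finset.univ.image g).card = m := by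
    rw [Finset.card_image_of_injective _ hinj]; simp
  refine this.symm.le.trans (Finset.card_le_card ?_)
  intro c hc
  obtain ⟨k, -, rfl⟩ := Finset.mem_image.1 hc
  refine Finset.mem_filter.2 ⟨hgS k, ?_⟩
  have h3 : f 0 ∈ cellEdge (g k) := by
    rw [← hg k]; simp
  simpa [cellEdge, onLine] using h3

/-- a good next move for Alice -/
def Good {n : ℕ} (m : ℕ) (A B : Finset (Fin n × Fin n)) (e : Fin n × Fin n) : Prop :=
  e ∉ A ∧ e ∉ B ∧ (Big m (insert e A) ∨
      (∃ f, f ∉ insert e A ∧ f ∉ B) ∧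
      (∀ f, f ∉ insert e A → f ∉ B → ¬ Big m (insert f B)) ∧
      (∀ f, f ∉ insert e A → f ∉ B → Wins m (insert e A) (insert f B)))

theorem exists_good {n m : ℕ} {A B : Finset (Fin n × Fin n)} (h : Wins m A B) :
    ∃ e, Good m A B e := by
  cases h with
  | win e _ _ h1 h2 h3 => exact ⟨e, h1, h2, Or.inl h3⟩
  | step e _ _ h1 h2 h3 h4 h5 => exact ⟨e, h1, h2, Or.inr ⟨h3, h4, h5⟩⟩

theorem length_le {n : ℕ} (l : List (Sym2 (Fin n ⊕ Fin n))) (hl : l.Nodup)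
    (he : ∀ e ∈ l, e ∈ (completeBipartiteGraph (Fin n) (Fin n)).edgeSet) :
    l.length ≤ (completeBipartiteGraph (Fin n) (Fin n)).edgeSet.ncard := by
  classical
  rw [← List.toFinset_card_of_nodup hl, ← Set.ncard_coe_finset]
  apply Set.ncard_le_ncard _ (Set.toFinite _)
  intro e h
  exact he e (by simpa using h)

theorem aliceWins_of_wins {n m : ℕ} (hm : 0 < m) (hn : 0 < n)
    (h0 : Wins m (∅ : Finset (Fin n × Fin n)) ∅) :
    AliceWins (star m) (completeBipartiteGraph (Fin n) (Fin n)) := by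
  have hex : ∀ l : List (Sym2 (Fin n ⊕ Fin n)), ∃ x : Sym2 (Fin n ⊕ Fin n),
      ((∃ e ∈ (completeBipartiteGraph (Fin n) (Fin n)).edgeSet, e ∉ l) →
        x ∈ (completeBipartiteGraph (Fin n) (Fin n)).edgeSet ∧ x ∉ l) ∧
      (Wins m (cells 0 l) (cells 1 l) → ∃ e, x = cellEdge e ∧
        Good m (cells 0 l) (cells 1 l) e) := by
    intro l
    by_cases hw : Wins m (cells 0 l) (cells 1 l)
    · obtain ⟨e, he⟩ := exists_good hw
      refine ⟨cellEdge e, fun _ => ⟨(mem_edges _).2 ⟨e, rfl⟩, ?_⟩, fun _ => ⟨e, rfl, he⟩⟩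
      rw [notMem_list]
      exact ⟨he.1, he.2.1⟩
    · by_cases hf : ∃ e ∈ (completeBipartiteGraph (Fin n) (Fin n)).edgeSet, e ∉ l
      · obtain ⟨e, he⟩ := hf
        exact ⟨e, fun _ => he, fun h => absurd h hw⟩
      · exact ⟨cellEdge (⟨0, hn⟩, ⟨0, hn⟩), fun h => absurd h hf, fun h => absurd h hw⟩
  obtain ⟨σ, hσv, hσ⟩ : ∃ σ : Strategy (Fin n ⊕ Fin n),
      Strategy.Valid (completeBipartiteGraph (Fin n) (Fin n)) σ ∧
      ∀ l, Wins m (cells 0 l) (cells 1 l) → ∃ e, σ l = cellEdge e ∧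
        Good m (cells 0 l) (cells 1 l) e := by
    choose σ h1 h2 using hex
    exact ⟨σ, h1, h2⟩
  refine ⟨σ, hσv, ?_⟩
  intro τ hτ
  by_contra hno
  have inv : ∀ t, (hist σ τ (2 * t)).Nodup ∧
      (∀ e ∈ hist σ τ (2 * t), e ∈ (completeBipartiteGraph (Fin n) (Fin n)).edgeSet) ∧
      Wins m (cells 0 (hist σ τ (2 * t))) (cells 1 (hist σ τ (2 * t))) ∧
      ¬ Big m (cells 1 (hist σ τ (2 * t))) := by
    intro t
    induction t with
    | zero =>
      have h1 : cells 0 (hist σ τ (2 * 0)) = ∅ := by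
        ext c; rw [mem_cells]; simp [hist]
      have h2 : cells 1 (hist σ τ (2 * 0)) = ∅ := by
        ext c; rw [mem_cells]; simp [hist]
      refine ⟨by simp [hist], by simp [hist], ?_, ?_⟩
      · rw [h1, h2]; exact h0
      · rw [h2]
        rintro ⟨v, hv⟩
        rw [cnt_empty] at hv
        omega
    | succ t ih =>
      obtain ⟨hnd, hed, hw, hb⟩ := ih
      obtain ⟨e, he, heA, heB, hgood⟩ := hσ _ hw
      have hlen := hist_length σ τ (2 * t)
      have hstep1 : hist σ τ (2 * t + 1) = hist σ τ (2 * t) ++ [cellEdge e] := by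
        simp only [hist]
        rw [if_pos (by omega), he]
      have hmove : move σ τ (2 * t) = cellEdge e := by
        unfold move
        rw [if_pos (by omega), he]
      have hnot : cellEdge e ∉ hist σ τ (2 * t) := (notMem_list _ _).2 ⟨heA, heB⟩
      have hnd1 : (hist σ τ (2 * t + 1)).Nodup := by
        rw [hstep1, List.nodup_append]
        refine ⟨hnd, by simp, ?_⟩
        intro a ha b hb'
        rw [List.mem_singleton] at hb'
        rintro rfl
        exact hnot (hb' ▸ ha)
      have hed1 : ∀ x ∈ hist σ τ (2 * t + 1),
          x ∈ (completeBipartiteGraph (Fin n) (Fin n)).edgeSet := by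
        intro x hx
        rw [hstep1, List.mem_append, List.mem_singleton] at hx
        rcases hx with hx | rfl
        · exact hed x hx
        · exact (mem_edges _).2 ⟨e, rfl⟩
      rcases hgood with hbig | ⟨⟨f0, hf0A, hf0B⟩, hnb, hnw⟩
      · exfalso
        apply hno
        refine ⟨t, ?_, ?_, ?_⟩
        · have := length_le _ hnd1 hed1
          rwa [hist_length] at this
        · apply hasCopy_of_big (insert e (cells 0 (hist σ τ (2 * t)))) _ _ hbig
          intro c hc
          rcases Finset.mem_insert.1 hc with rfl | hc
          · exact ⟨t, le_rfl, hmove.symm⟩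
          · obtain ⟨i, hi⟩ := (mem_cells _ _ _).1 hc
            have hlt : 2 * i + 0 < 2 * t := by
              by_contra h
              rw [List.getElem?_eq_none (by omega)] at hi
              simp at hi
            rw [hist_get _ _ _ _ hlt, Option.some.injEq] at hi
            exact ⟨i, by omega, hi.symm⟩
        · intro hc
          apply hb
          apply big_of_hasCopy _ _ _ hc
          rintro x ⟨i, hi, rfl⟩
          have hg := hist_get σ τ (2 * t) (2 * i + 1) (by omega)
          obtain ⟨c, hc⟩ := (mem_edges _).1 (hed _ (List.mem_of_getElem? hg))
          refine ⟨c, (mem_cells _ _ _).2 ⟨i, ?_⟩, hc⟩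
          rw [hg, hc]
      · have hfree : ∀ f, f ∉ insert e (cells 0 (hist σ τ (2 * t))) ∧
            f ∉ cells 1 (hist σ τ (2 * t)) ↔ cellEdge f ∉ hist σ τ (2 * t + 1) := by
          intro f
          rw [hstep1, List.mem_append, List.mem_singleton, not_or, notMem_list, cellEdge_inj,
            Finset.mem_insert]
          tauto
        obtain ⟨hτ1, hτ2⟩ := hτ (hist σ τ (2 * t + 1))
          ⟨cellEdge f0, (mem_edges _).2 ⟨f0, rfl⟩, (hfree f0).1 ⟨hf0A, hf0B⟩⟩
        obtain ⟨f, hf⟩ := (mem_edges _).1 hτ1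
        have hstep2 : hist σ τ (2 * (t + 1)) = hist σ τ (2 * t + 1) ++ [cellEdge f] := by
          rw [← hf]
          change hist σ τ (2 * t + 1 + 1) = _
          rw [hist, if_neg (by omega)]
        rw [hf] at hτ2
        obtain ⟨hfA, hfB⟩ := (hfree f).2 hτ2
        have hc := cells_append (hist σ τ (2 * t)) hlen e f
        rw [← hstep1, ← hstep2] at hc
        rw [hc.1, hc.2]
        refine ⟨?_, ?_, hnw f hfA hfB, hnb f hfA hfB⟩
        · rw [hstep2, List.nodup_append]
          refine ⟨hnd1, by simp, ?_⟩
          intro a ha b hb'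
          rw [List.mem_singleton] at hb'
          rintro rfl
          exact hτ2 (hb' ▸ ha)
        · intro x hx
          rw [hstep2, List.mem_append, List.mem_singleton] at hx
          rcases hx with hx | rfl
          · exact hed1 x hx
          · exact (mem_edges _).2 ⟨f, rfl⟩
  obtain ⟨h1, h2, -, -⟩ := inv ((completeBipartiteGraph (Fin n) (Fin n)).edgeSet.ncard + 1)
  have := length_le _ h1 h2
  rw [hist_length] at this
  omega

end AchievementGame

open AchievementGame

/-- For every integer `m ≥ 4`, the bipartite achievement number of the star satisfies
`ba(K_{1,m}) ≤ 2m − 3`; that is, Alice has a winning strategy in the achievement game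
`(K_{1,m}, K_{2m-3,2m-3}, +)`. -/
theorem stmt13 (m : ℕ) (hm : 4 ≤ m) :
    AliceWins (star m) (completeBipartiteGraph (Fin (2 * m - 3)) (Fin (2 * m - 3))) := by
  exact aliceWins_of_wins (by omega) (by omega) (wins_start hm rfl)
end
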